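/- Let d≥3 be an integer, W=ℝ^{d+1}, D=binom(d+1,2). Let G=(V,E) be a finite multigraph and {B,R} a partition of V. Then there exist a rod-configuration r on R (assigning to each v∈R a nonzero decomposable element r_v∈⋀^{d−1}W, with r_u and r_v not scalar multiples of each other for distinct u,v∈R) and, for each edge e∈E, vectors a_e,b_e∈W such that q_e := a_e∧b_e ≠ 0 and q_e∧r_w = 0 in ⋀^{d+1}W for every endpoint w of e with w∈R, with the following property: for every subset I⊆E, the family of vectors (v_e)_{e∈I} in the space of functions V→⋀²W — where, for e with endpoints u and v, v_e = δ_u·q_e − δ_v·q_e — is linearly independent if and only if |F| ≤ D·|V(F)| − D − |R(F)| for every nonempty F⊆I, where R(F)=V(F)∩R. (This is the generic body-rod-bar matroid theorem: the rigidity matroid of a body-rod-bar framework with a suitable bar- and rod-configuration equals the count matroid induced by f(F)=D(|V(F)|−1)−|R(F)|.) -/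

import Mathlib

/- STATEMENT 0: generic body-rod-bar matroid theorem. -/

set_option synthInstance.maxHeartbeats 1000000
set_option maxHeartbeats 1000000

open ExteriorAlgebra

/-- `W = ℝ^{d+1}`. -/
abbrev Wd (d : ℕ) : Type := Fin (d + 1) → ℝ

/-- The exterior algebra of `W = ℝ^{d+1}`; the exterior powers `⋀^k W` are realized as
the degree-`k` homogeneous submodules of this algebra, and the exterior product is the
algebra multiplication. -/
abbrev ExtAlg (d : ℕ) : Type := ExteriorAlgebra ℝ (Wd d)

/-- `x` is a decomposable element of `⋀^k W`, i.e. `x = w₁ ∧ ⋯ ∧ w_k`. -/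
def IsDecomp (d k : ℕ) (x : ExtAlg d) : Prop :=
  ∃ w : Fin k → Wd d, x = (List.ofFn fun i => ι ℝ (w i)).prod

/-- The set `V(F)` of vertices spanned by an edge set `F`. -/
def VF {V E : Type} [DecidableEq V] (ends : E → V × V) (F : Finset E) : Finset V :=
  F.image (fun e => (ends e).1) ∪ F.image (fun e => (ends e).2)

namespace BRB

open Module

/-! ### Functions polynomial along lines -/

def LP {X : Type*} [AddCommGroup X] [Module ℝ X] (F : X → ℝ) : Prop :=
  ∀ P Q, ∃ p : Polynomial ℝ, ∀ t : ℝ, F (P + t • Q) = p.eval t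

def LO {X : Type*} [AddCommGroup X] [Module ℝ X] (G : X → Prop) : Prop :=
  ∀ P Q, G P → {t : ℝ | ¬ G (P + t • Q)}.Finite

section LP
variable {X : Type*} [AddCommGroup X] [Module ℝ X]

lemma LP.const (c : ℝ) : LP (fun _ : X => c) := fun P Q => ⟨Polynomial.C c, by simp⟩

lemma LP.add {F G : X → ℝ} (hF : LP F) (hG : LP G) : LP (fun x => F x + G x) := by
  intro P Q
  obtain ⟨p, hp⟩ := hF P Q
  obtain ⟨q, hq⟩ := hG P Q
  exact ⟨p + q, fun t => by simp [hp, hq]⟩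

lemma LP.mul {F G : X → ℝ} (hF : LP F) (hG : LP G) : LP (fun x => F x * G x) := by
  intro P Q
  obtain ⟨p, hp⟩ := hF P Q
  obtain ⟨q, hq⟩ := hG P Q
  exact ⟨p * q, fun t => by simp [hp, hq]⟩

lemma LP.sub {F G : X → ℝ} (hF : LP F) (hG : LP G) : LP (fun x => F x - G x) := by
  intro P Q
  obtain ⟨p, hp⟩ := hF P Q
  obtain ⟨q, hq⟩ := hG P Q
  exact ⟨p - q, fun t => by simp [hp, hq]⟩

lemma LP.sum {α : Type*} (s : Finset α) {F : α → X → ℝ} (hF : ∀ i ∈ s, LP (F i)) :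
    LP (fun x => ∑ i ∈ s, F i x) := by
  classical
  induction s using Finset.induction_on with
  | empty => simpa using LP.const 0
  | insert a s ha ih =>
    simp only [Finset.sum_insert ha]
    exact (hF a (by simp)).add (ih fun i hi => hF i (by simp [hi]))

lemma LP.prod {α : Type*} (s : Finset α) {F : α → X → ℝ} (hF : ∀ i ∈ s, LP (F i)) :
    LP (fun x => ∏ i ∈ s, F i x) := by
  classical
  induction s using Finset.induction_on with
  | empty => simpa using LP.const 1
  | insert a s ha ih =>
    simp only [Finset.prod_insert ha]
    exact (hF a (by simp)).mul (ih fun i hi => hF i (by simp [hi]))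

lemma LP.lin (f : X →ₗ[ℝ] ℝ) : LP (fun x => f x) := fun P Q =>
  ⟨Polynomial.C (f P) + Polynomial.X * Polynomial.C (f Q), fun t => by
    beta_reduce
    rw [map_add, map_smul, smul_eq_mul]
    simp only [Polynomial.eval_add, Polynomial.eval_mul, Polynomial.eval_C, Polynomial.eval_X]⟩

lemma LP.ne_zero {F : X → ℝ} (hF : LP F) : LO (fun x => F x ≠ 0) := by
  intro P Q h
  obtain ⟨p, hp⟩ := hF P Q
  have hp0 : p ≠ 0 := by
    rintro rfl
    have := hp 0
    simp at this
    exact h this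
  refine (p.roots.toFinset.finite_toSet).subset ?_
  intro t ht
  simp only [Set.mem_ofPred_eq, not_not] at ht
  rw [hp] at ht
  simp [hp0, ht]

lemma LO.and {G H : X → Prop} (hG : LO G) (hH : LO H) : LO (fun x => G x ∧ H x) := by
  rintro P Q ⟨h1, h2⟩
  refine ((hG P Q h1).union (hH P Q h2)).subset ?_
  intro t ht
  simp only [Set.mem_ofPred_eq, Set.mem_union] at ht ⊢
  tauto

lemma LO.exists_and {G H : X → Prop} (hG : LO G) (hH : LO H) (h1 : ∃ x, G x) (h2 : ∃ x, H x) :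
    ∃ x, G x ∧ H x := by
  obtain ⟨P, hP⟩ := h1
  obtain ⟨Q, hQ⟩ := h2
  have f1 := hG P (Q - P) hP
  have f2 := hH Q (P - Q) hQ
  have f2' : {t : ℝ | ¬ H (P + t • (Q - P))}.Finite := by
    refine (f2.image (fun t => 1 - t)).subset ?_
    intro t ht
    refine ⟨1 - t, ?_, by ring⟩
    have e : Q + (1 - t) • (P - Q) = P + t • (Q - P) := by module
    simpa [e] using ht
  obtain ⟨t, ht⟩ := (f1.union f2').infinite_compl.nonempty
  simp only [Set.mem_compl_iff, Set.mem_union, Set.mem_ofPred_eq, not_or, not_not] at ht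
  exact ⟨_, ht⟩

lemma LO.true : LO (fun _ : X => True) := by
  intro P Q _
  simp

lemma LO.all {α : Type*} (s : Set α) (hs : s.Finite) {G : α → X → Prop} (hG : ∀ i ∈ s, LO (G i)) :
    LO (fun x => ∀ i ∈ s, G i x) := by
  intro P Q h
  refine (hs.biUnion fun i hi => hG i hi P Q (h i hi)).subset ?_
  intro t ht
  simp only [Set.mem_ofPred_eq, not_forall] at ht
  obtain ⟨i, hi, h⟩ := ht
  simp only [Set.mem_iUnion]
  exact ⟨i, hi, h⟩

lemma LO.exists_all {α : Type*} (s : Set α) (hs : s.Finite) {G : α → X → Prop}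
    (hG : ∀ i ∈ s, LO (G i)) (hne : ∀ i ∈ s, ∃ x, G i x) : ∃ x, ∀ i ∈ s, G i x := by
  induction s, hs using Set.Finite.induction_on with
  | empty => exact ⟨0, by simp⟩
  | @insert a s ha hs ih =>
    have := LO.exists_and (hG a (by simp))
      (LO.all s hs fun i hi => hG i (by simp [hi])) (hne a (by simp))
      (ih (fun i hi => hG i (by simp [hi])) (fun i hi => hne i (by simp [hi])))
    simpa using this

lemma LO.comp {Y : Type*} [AddCommGroup Y] [Module ℝ Y] {G : X → Prop} (hG : LO G)
    (L : Y →ₗ[ℝ] X) (c : X) : LO (fun y => G (c + L y)) := by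
  intro P Q h
  have := hG (c + L P) (L Q) h
  simpa [add_assoc] using this

def LPv {N : Type*} [AddCommGroup N] [Module ℝ N] (w : X → N) : Prop :=
  ∀ φ : Dual ℝ N, LP (fun x => φ (w x))

lemma LPv.sum {N : Type*} [AddCommGroup N] [Module ℝ N] {α : Type*} (s : Finset α)
    {c : α → X → ℝ} (n : α → N) (hc : ∀ i ∈ s, LP (c i)) :
    LPv (fun x => ∑ i ∈ s, c i x • n i) := by
  intro φ
  simp only [map_sum, map_smul, smul_eq_mul]
  exact LP.sum s fun i hi => (hc i hi).mul (LP.const _)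

lemma LPv.pi {α : Type*} [Fintype α] [DecidableEq α] {w : X → α → ℝ}
    (hw : ∀ i, LP (fun x => w x i)) : LPv w := by
  have : w = fun x => ∑ i, w x i • (Pi.single i (1:ℝ) : α → ℝ) := by
    funext x
    exact pi_eq_sum_univ' (w x)
  rw [this]
  exact LPv.sum _ _ fun i _ => hw i

lemma LPv.lin {N N' : Type*} [AddCommGroup N] [Module ℝ N] [AddCommGroup N'] [Module ℝ N']
    {w : X → N} (hw : LPv w) (L : N →ₗ[ℝ] N') : LPv (fun x => L (w x)) :=
  fun φ => hw (φ ∘ₗ L)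

lemma LPv.sub {N : Type*} [AddCommGroup N] [Module ℝ N] {w w' : X → N} (h : LPv w) (h' : LPv w') :
    LPv (fun x => w x - w' x) := by
  intro φ
  simp only [map_sub]
  exact (h φ).sub (h' φ)

lemma LPv.const {N : Type*} [AddCommGroup N] [Module ℝ N] (n : N) : LPv (fun _ : X => n) :=
  fun _ => LP.const _

lemma LPv.LI {N : Type*} [AddCommGroup N] [Module ℝ N] {α : Type*} [Fintype α]
    {w : α → X → N} (hw : ∀ i, LPv (w i)) :
    LO (fun x => LinearIndependent ℝ (fun i => w i x)) := by
  classical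
  intro P Q h
  have hinj : LinearMap.ker (Fintype.linearCombination ℝ (fun i => w i P)) = ⊥ := by
    rw [LinearMap.ker_eq_bot]
    exact h.fintypeLinearCombination_injective
  obtain ⟨L, hL⟩ := LinearMap.exists_leftInverse_of_injective _ hinj
  let A : X → Matrix α α ℝ := fun x => Matrix.of fun i j => L (w i x) j
  have hA : LP (fun x => (A x).det) := by
    simp only [Matrix.det_apply']
    refine LP.sum _ fun σ _ => (LP.const _).mul (LP.prod _ fun i _ => ?_)
    exact hw _ ((LinearMap.proj i) ∘ₗ L)
  have h1 : (A P).det ≠ 0 := by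
    have : A P = 1 := by
      ext i j
      have := congrArg (fun f => f (Pi.single i (1:ℝ)) j) hL
      simp [Fintype.linearCombination_apply_single] at this
      simp only [A, Matrix.of_apply, this, Matrix.one_apply, Pi.single_apply, eq_comm]
    rw [this]; simp
  refine (hA.ne_zero P Q h1).subset ?_
  intro t ht
  simp only [Set.mem_ofPred_eq, not_not] at ht ⊢
  by_contra hne
  apply ht
  have h2 : LinearIndependent ℝ (fun i => (A (P + t • Q)) i) :=
    Matrix.linearIndependent_rows_of_det_ne_zero hne
  exact LinearIndependent.of_comp L h2

lemma LPv.bilin {W W' N : Type*} [AddCommGroup W] [Module ℝ W] [AddCommGroup W'] [Module ℝ W']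
    [AddCommGroup N] [Module ℝ N]
    (β : W →ₗ[ℝ] W' →ₗ[ℝ] N) (L : X →ₗ[ℝ] W) (L' : X →ₗ[ℝ] W') (c : W) (c' : W') :
    LPv (fun x => β (c + L x) (c' + L' x)) := by
  intro φ P Q
  refine ⟨Polynomial.C (φ (β (c + L P) (c' + L' P))) +
    Polynomial.X * Polynomial.C (φ (β (L Q) (c' + L' P)) + φ (β (c + L P) (L' Q))) +
    Polynomial.X ^ 2 * Polynomial.C (φ (β (L Q) (L' Q))), fun t => ?_⟩
  simp
  ring

lemma LO.span_top {G : X → Prop} (hG : LO G) (hne : ∃ x, G x) (S : Submodule ℝ X)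
    (h : ∀ x, G x → x ∈ S) (x : X) : x ∈ S := by
  obtain ⟨P, hP⟩ := hne
  obtain ⟨t, ht⟩ := ((hG P x hP).union (Set.finite_singleton (0:ℝ))).infinite_compl.nonempty
  simp only [Set.mem_compl_iff, Set.mem_union, Set.mem_ofPred_eq, not_or, not_not,
    Set.mem_singleton_iff] at ht
  have h1 := h _ ht.1
  have h2 := h _ hP
  have h3 : t • x ∈ S := by simpa using S.sub_mem h1 h2
  exact (S.smul_mem_iff ht.2).1 h3

end LP

end BRB

namespace BRB
open Module

/-! ### Concrete model of two-forms -/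

section Geom
set_option linter.unusedSectionVars false

abbrev Kp (d : ℕ) : Type := {p : Fin (d + 1) × Fin (d + 1) // p.1 < p.2}
abbrev Mm (d : ℕ) : Type := Kp d → ℝ
abbrev Nn (d : ℕ) : Type := Dual ℝ (Mm d)

variable {d : ℕ}

lemma sum_pairs {A : Type*} [AddCommMonoid A] (f : Fin (d + 1) → Fin (d + 1) → A)
    (hf : ∀ i, f i i = 0) :
    ∑ p : Kp d, (f p.1.1 p.1.2 + f p.1.2 p.1.1) = ∑ i, ∑ j, f i j := by
  rw [Finset.sum_add_distrib, ← Finset.sum_product', ← Finset.univ_product_univ.symm]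
  rw [← Finset.sum_filter_add_sum_filter_not _ (fun p : Fin (d+1) × Fin (d+1) => p.1 < p.2)]
  have h1 : ∑ p : Kp d, f p.1.1 p.1.2 =
      ∑ p ∈ Finset.univ.filter (fun p : Fin (d+1) × Fin (d+1) => p.1 < p.2), f p.1 p.2 := by
    rw [Finset.sum_subtype (p := fun p : Fin (d+1) × Fin (d+1) => p.1 < p.2)]
    simp
  have h2 : ∑ p : Kp d, f p.1.2 p.1.1 =
      ∑ p ∈ Finset.univ.filter (fun p : Fin (d+1) × Fin (d+1) => p.1 < p.2), f p.2 p.1 := by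
    rw [Finset.sum_subtype (p := fun p : Fin (d+1) × Fin (d+1) => p.1 < p.2)
      (f := fun p : Fin (d+1) × Fin (d+1) => f p.2 p.1)]
    simp
  rw [h1, h2]
  congr 1
  rw [← Finset.sum_filter_add_sum_filter_not
    (Finset.univ.filter (fun p : Fin (d+1) × Fin (d+1) => ¬ p.1 < p.2)) (fun p => p.1 = p.2)]
  have h3 : ∑ x ∈ (Finset.univ.filter (fun p : Fin (d+1) × Fin (d+1) => ¬ p.1 < p.2)).filter
      (fun p => p.1 = p.2), f x.1 x.2 = 0 := by
    apply Finset.sum_eq_zero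
    rintro ⟨a, b⟩ h
    simp at h
    simp [h.2, hf]
  rw [h3, zero_add]
  refine Finset.sum_bij (fun p _ => (p.2, p.1)) ?_ ?_ ?_ ?_
  · rintro ⟨a, b⟩ h
    simp at h ⊢
    exact ⟨h.le, h.ne'⟩
  · rintro ⟨a, b⟩ _ ⟨a', b'⟩ _ h
    simp at h ⊢
    tauto
  · rintro ⟨a, b⟩ h
    simp at h
    exact ⟨(b, a), by simp; exact lt_of_le_of_ne h.1 (Ne.symm h.2), rfl⟩
  · intros; rfl

lemma card_Kp : Fintype.card (Kp d) = (d + 1).choose 2 := by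
  have h := sum_pairs (d := d) (fun i j => if i = j then 0 else 1) (by simp)
  have h1 : ∑ p : Kp d, ((if p.1.1 = p.1.2 then 0 else 1) + (if p.1.2 = p.1.1 then 0 else 1)) =
      Fintype.card (Kp d) * 2 := by
    rw [Finset.sum_congr rfl (g := fun _ => 2)]
    · simp
    · intro p _
      simp [p.2.ne, p.2.ne']
  rw [h1] at h
  have h2 : ∀ i : Fin (d+1), ∑ j, (if i = j then 0 else 1) = d := by
    intro i
    have : ∑ j, (if i = j then 0 else 1) + ∑ j, (if i = j then 1 else 0) = d + 1 := by
      rw [← Finset.sum_add_distrib, Finset.sum_congr rfl (g := fun _ => 1)]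
      · simp
      · intro j _; split_ifs <;> rfl
    simp at this
    simpa using this
  simp only [h2] at h
  simp at h
  rw [Nat.choose_two_right]
  simp
  omega

def wdg : Wd d →ₗ[ℝ] Wd d →ₗ[ℝ] Mm d :=
  LinearMap.mk₂ ℝ (fun a b p => a p.1.1 * b p.1.2 - a p.1.2 * b p.1.1)
    (by intros; funext p; simp; ring) (by intros; funext p; simp; ring)
    (by intros; funext p; simp; ring) (by intros; funext p; simp; ring)

lemma wdg_apply (a b : Wd d) (p : Kp d) :
    wdg a b p = a p.1.1 * b p.1.2 - a p.1.2 * b p.1.1 := rfl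

lemma wdg_swap (a b : Wd d) : wdg a b = - wdg b a := by
  funext p; simp [wdg_apply]; ring

lemma wdg_self (a : Wd d) : wdg a a = 0 := by
  funext p; simp [wdg_apply]; ring

lemma wdg_basis (p : Kp d) :
    wdg (Pi.single p.1.1 1) (Pi.single p.1.2 1) = (Pi.single p 1 : Mm d) := by
  funext q
  rw [wdg_apply]
  have hp := p.2
  have hq := q.2
  simp only [Pi.single_apply, Subtype.ext_iff, Prod.ext_iff]
  by_cases h1 : q.1.1 = p.1.1 <;> by_cases h2 : q.1.2 = p.1.2 <;> simp [h1, h2]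
  all_goals (intro h3 h4; simp only [Fin.lt_def, Fin.ext_iff] at *; omega)

lemma wdg_span (S : Submodule ℝ (Mm d)) (h : ∀ a b, wdg a b ∈ S) : S = ⊤ := by
  rw [eq_top_iff]
  intro m _
  rw [pi_eq_sum_univ' m]
  refine S.sum_mem fun p _ => S.smul_mem _ ?_
  rw [← wdg_basis p]
  exact h _ _

lemma Nn_ext {φ ψ : Nn d} (h : ∀ a b, φ (wdg a b) = ψ (wdg a b)) : φ = ψ := by
  have := wdg_span (LinearMap.eqLocus φ ψ) h
  ext1 
  exact LinearMap.eqLocus_eq_top.1 this ▸ rfl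

def be : Wd d →ₗ[ℝ] Wd d →ₗ[ℝ] Nn d := wdg.compr₂ (dotProductEquiv ℝ (Kp d)).toLinearMap

lemma be_eq (ξ η : Wd d) : be ξ η = dotProductEquiv ℝ (Kp d) (wdg ξ η) := rfl

lemma be_wdg (ξ η a b : Wd d) :
    be ξ η (wdg a b) = (ξ ⬝ᵥ a) * (η ⬝ᵥ b) - (ξ ⬝ᵥ b) * (η ⬝ᵥ a) := by
  have h := sum_pairs (d := d) (fun i j => ξ i * η j * (a i * b j - a j * b i)) (by intro i; ring)
  have h1 : be ξ η (wdg a b) = ∑ p : Kp d, wdg ξ η p * wdg a b p := rfl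
  rw [h1]
  simp only [dotProduct, Finset.sum_mul_sum]
  rw [← Finset.sum_sub_distrib]
  simp only [← Finset.sum_sub_distrib]
  have h2 : ∑ p : Kp d, wdg ξ η p * wdg a b p = ∑ i, ∑ j, ξ i * η j * (a i * b j - a j * b i) := by
    rw [← h]
    apply Finset.sum_congr rfl
    intro p _
    simp only [wdg_apply]; ring
  rw [h2]
  · apply Finset.sum_congr rfl
    intro i _
    apply Finset.sum_congr rfl
    intro j _
    ring

lemma be_span (S : Submodule ℝ (Nn d)) (h : ∀ a b, be a b ∈ S) : S = ⊤ := by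
  have := wdg_span (S.comap (dotProductEquiv ℝ (Kp d)).toLinearMap) h
  rw [eq_top_iff]
  intro n _
  obtain ⟨m, rfl⟩ := (dotProductEquiv ℝ (Kp d)).surjective n
  have : m ∈ (S.comap (dotProductEquiv ℝ (Kp d)).toLinearMap) := by rw [this]; trivial
  exact this

lemma finrank_Nn : finrank ℝ (Nn d) = (d + 1).choose 2 := by
  rw [Subspace.dual_finrank_eq, finrank_pi, card_Kp]

lemma dual_vecs {α : Type*} [Fintype α] [DecidableEq α] {f : α → Wd d}
    (h : LinearIndependent ℝ f) : ∃ x : α → Wd d, ∀ i j, f i ⬝ᵥ x j = if i = j then 1 else 0 := by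
  have hinj : LinearMap.ker (Fintype.linearCombination ℝ f) = ⊥ := by
    rw [LinearMap.ker_eq_bot]
    exact h.fintypeLinearCombination_injective
  obtain ⟨L, hL⟩ := LinearMap.exists_leftInverse_of_injective _ hinj
  refine ⟨fun j => (dotProductEquiv ℝ (Fin (d+1))).symm ((LinearMap.proj j) ∘ₗ L), ?_⟩
  intro i j
  rw [dotProduct_comm]
  have h1 : ∀ (φ : Dual ℝ (Wd d)) (v : Wd d), (dotProductEquiv ℝ (Fin (d+1))).symm φ ⬝ᵥ v = φ v := by
    intro φ v
    obtain ⟨w, rfl⟩ := (dotProductEquiv ℝ (Fin (d+1))).surjective φ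
    rw [LinearEquiv.symm_apply_apply]; rfl
  rw [h1]
  have := congrArg (fun f => f (Pi.single i (1:ℝ)) j) hL
  simp [Fintype.linearCombination_apply_single] at this
  simp [this, Pi.single_apply, eq_comm]

def onU (b : Prop) (f : Fin 2 → Wd d) (a : Wd d) : Prop := b → ∀ i, f i ⬝ᵥ a = 0

open Classical in
noncomputable def rr (b : Prop) (f : Fin 2 → Wd d) : Nn d := if b then be (f 0) (f 1) else 0

lemma span_lemma {f f' : Fin 2 → Wd d} (h : LinearIndependent ℝ ![f 0, f 1, f' 0, f' 1])
    (b b' : Prop) (φ : Nn d) (hφ : ∀ a c, onU b f a → onU b' f' c → φ (wdg a c) = 0) :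
    ∃ s t : ℝ, φ = s • rr b f + t • rr b' f' := by
  obtain ⟨x, hx⟩ := dual_vecs h
  have e : ∀ i j, (![f 0, f 1, f' 0, f' 1] : Fin 4 → Wd d) i ⬝ᵥ x j = if i = j then 1 else 0 := hx
  have e00 := e 0 0
  have e01 := e 0 1
  have e02 := e 0 2
  have e03 := e 0 3
  have e10 := e 1 0
  have e11 := e 1 1
  have e12 := e 1 2
  have e13 := e 1 3
  have e20 := e 2 0
  have e21 := e 2 1
  have e22 := e 2 2
  have e23 := e 2 3
  have e30 := e 3 0
  have e31 := e 3 1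
  have e32 := e 3 2
  have e33 := e 3 3
  simp at e00 e01 e02 e03 e10 e11 e12 e13 e20 e21 e22 e23 e30 e31 e32 e33
  have hz : ∀ a c, f 0 ⬝ᵥ a = 0 → f 1 ⬝ᵥ a = 0 → f' 0 ⬝ᵥ c = 0 → f' 1 ⬝ᵥ c = 0 →
      φ (wdg a c) = 0 := by
    intro a c h1 h2 h3 h4
    refine hφ a c ?_ ?_
    · intro _ i; fin_cases i <;> assumption
    · intro _ i; fin_cases i <;> assumption
  have hz' : ∀ a c, f 0 ⬝ᵥ a = 0 → f 1 ⬝ᵥ a = 0 → f' 0 ⬝ᵥ c = 0 → f' 1 ⬝ᵥ c = 0 →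
      φ (wdg c a) = 0 := by
    intro a c h1 h2 h3 h4
    rw [wdg_swap, map_neg, hz a c h1 h2 h3 h4, neg_zero]
  have main : φ = φ (wdg (x 0) (x 1)) • be (f 0) (f 1) + φ (wdg (x 2) (x 3)) • be (f' 0) (f' 1) := by
    apply Nn_ext
    intro a c
    have dec : ∀ w : Wd d, ∃ w0, w = w0 + ((f 0 ⬝ᵥ w) • x 0 + (f 1 ⬝ᵥ w) • x 1) +
        ((f' 0 ⬝ᵥ w) • x 2 + (f' 1 ⬝ᵥ w) • x 3) ∧ f 0 ⬝ᵥ w0 = 0 ∧ f 1 ⬝ᵥ w0 = 0 ∧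
        f' 0 ⬝ᵥ w0 = 0 ∧ f' 1 ⬝ᵥ w0 = 0 := by
      intro w
      refine ⟨w - ((f 0 ⬝ᵥ w) • x 0 + (f 1 ⬝ᵥ w) • x 1) - ((f' 0 ⬝ᵥ w) • x 2 + (f' 1 ⬝ᵥ w) • x 3),
        by abel, ?_, ?_, ?_, ?_⟩ <;>
      simp [dotProduct_sub, dotProduct_add, dotProduct_smul, *]
    obtain ⟨a0, ha, a1, a2, a3, a4⟩ := dec a
    obtain ⟨c0, hc, c1, c2, c3, c4⟩ := dec c
    simp only [LinearMap.add_apply, LinearMap.smul_apply, be_wdg, smul_eq_mul]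
    generalize f 0 ⬝ᵥ a = α0 at *
    generalize f 1 ⬝ᵥ a = α1 at *
    generalize f' 0 ⬝ᵥ a = α2 at *
    generalize f' 1 ⬝ᵥ a = α3 at *
    generalize f 0 ⬝ᵥ c = γ0 at *
    generalize f 1 ⬝ᵥ c = γ1 at *
    generalize f' 0 ⬝ᵥ c = γ2 at *
    generalize f' 1 ⬝ᵥ c = γ3 at *
    subst ha hc
    have z1 : φ (wdg a0 c0) = 0 := hz _ _ a1 a2 c3 c4
    have z2 : φ (wdg a0 (x 0)) = 0 := hz _ _ a1 a2 e20 e30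
    have z3 : φ (wdg a0 (x 1)) = 0 := hz _ _ a1 a2 e21 e31
    have z4 : φ (wdg a0 (x 2)) = 0 := hz' _ _ e02 e12 a3 a4
    have z5 : φ (wdg a0 (x 3)) = 0 := hz' _ _ e03 e13 a3 a4
    have z6 : φ (wdg (x 0) c0) = 0 := hz' _ _ c1 c2 e20 e30
    have z7 : φ (wdg (x 1) c0) = 0 := hz' _ _ c1 c2 e21 e31
    have z8 : φ (wdg (x 2) c0) = 0 := hz _ _ e02 e12 c3 c4
    have z9 : φ (wdg (x 3) c0) = 0 := hz _ _ e03 e13 c3 c4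
    have y1 : φ (wdg (x 2) (x 0)) = 0 := hz _ _ e02 e12 e20 e30
    have y2 : φ (wdg (x 2) (x 1)) = 0 := hz _ _ e02 e12 e21 e31
    have y3 : φ (wdg (x 3) (x 0)) = 0 := hz _ _ e03 e13 e20 e30
    have y4 : φ (wdg (x 3) (x 1)) = 0 := hz _ _ e03 e13 e21 e31
    have y5 : φ (wdg (x 0) (x 2)) = 0 := hz' _ _ e02 e12 e20 e30
    have y6 : φ (wdg (x 1) (x 2)) = 0 := hz' _ _ e02 e12 e21 e31
    have y7 : φ (wdg (x 0) (x 3)) = 0 := hz' _ _ e03 e13 e20 e30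
    have y8 : φ (wdg (x 1) (x 3)) = 0 := hz' _ _ e03 e13 e21 e31
    have s1 : φ (wdg (x 1) (x 0)) = - φ (wdg (x 0) (x 1)) := by rw [wdg_swap, map_neg]
    have s2 : φ (wdg (x 3) (x 2)) = - φ (wdg (x 2) (x 3)) := by rw [wdg_swap, map_neg]
    simp only [map_add, map_smul, LinearMap.add_apply, LinearMap.smul_apply, smul_eq_mul,
      wdg_self, map_zero, z1, z2, z3, z4, z5, z6, z7, z8, z9, y1, y2, y3, y4, y5, y6, y7, y8, s1, s2]
    ring
  refine ⟨φ (wdg (x 0) (x 1)), φ (wdg (x 2) (x 3)), ?_⟩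
  have r1 : φ (wdg (x 0) (x 1)) • rr b f = φ (wdg (x 0) (x 1)) • be (f 0) (f 1) := by
    by_cases hb : b
    · simp [rr, hb]
    · have : φ (wdg (x 0) (x 1)) = 0 := hφ _ _ (fun h => absurd h hb)
        (fun _ i => by fin_cases i <;> assumption)
      simp [this]
  have r2 : φ (wdg (x 2) (x 3)) • rr b' f' = φ (wdg (x 2) (x 3)) • be (f' 0) (f' 1) := by
    by_cases hb : b'
    · simp [rr, hb]
    · have : φ (wdg (x 2) (x 3)) = 0 := hφ _ _ (fun _ i => by fin_cases i <;> assumption)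
        (fun h => absurd h hb)
      simp [this]
  rw [r1, r2]
  exact main

lemma rr_wdg (b : Prop) {f : Fin 2 → Wd d} {a c : Wd d} (h : onU b f a ∨ onU b f c) :
    rr b f (wdg a c) = 0 := by
  by_cases hb : b
  · simp only [rr, hb, if_true, be_wdg]
    rcases h with h | h
    · rw [h hb 0, h hb 1]; ring
    · rw [h hb 0, h hb 1]; ring
  · simp [rr, hb]

def br (f : Fin 2 → Wd d) (x y : Wd d) : ℝ := (f 0 ⬝ᵥ x) * (f 1 ⬝ᵥ y) - (f 0 ⬝ᵥ y) * (f 1 ⬝ᵥ x)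

def tri (f : Fin 2 → Wd d) (z : Fin 3 → Wd d) : Wd d :=
  br f (z 1) (z 2) • z 0 + br f (z 2) (z 0) • z 1 + br f (z 0) (z 1) • z 2

open Classical in
noncomputable def pt (b : Prop) (f : Fin 2 → Wd d) (z : Fin 3 → Wd d) : Wd d :=
  if b then tri f z else z 0

lemma pt_onU (b : Prop) (f : Fin 2 → Wd d) (z : Fin 3 → Wd d) : onU b f (pt b f z) := by
  intro hb i
  simp only [pt, hb, if_true, tri, dotProduct_add, dotProduct_smul, smul_eq_mul, br]
  fin_cases i <;> simp <;> ring

lemma pt_surj (b : Prop) {f : Fin 2 → Wd d} (hf : LinearIndependent ℝ f) {a : Wd d}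
    (ha : onU b f a) : ∃ z, pt b f z = a := by
  obtain ⟨x, hx⟩ := dual_vecs hf
  by_cases hb : b
  · refine ⟨![a, x 0, x 1], ?_⟩
    simp only [pt, hb, if_true, tri, br]
    have h0 := ha hb 0
    have h1 := ha hb 1
    simp [h0, h1, hx]
  · exact ⟨fun _ => a, by simp [pt, hb]⟩

abbrev Prm (V E : Type) (d : ℕ) : Type := (V → Fin 2 → Wd d) × (E → Fin 2 → Fin 3 → Wd d)

section
variable {V E : Type} [DecidableEq V] (R : Finset V) (ends : E → V × V)

noncomputable def aV (P : Prm V E d) (e : E) : Wd d :=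
  pt ((ends e).1 ∈ R) (P.1 (ends e).1) (P.2 e 0)

noncomputable def bV (P : Prm V E d) (e : E) : Wd d :=
  pt ((ends e).2 ∈ R) (P.1 (ends e).2) (P.2 e 1)

noncomputable def qV (P : Prm V E d) (e : E) : Mm d := wdg (aV R ends P e) (bV R ends P e)

noncomputable def sgn (u v : V) : Mm d →ₗ[ℝ] (V → Mm d) :=
  LinearMap.single ℝ (fun _ : V => Mm d) u - LinearMap.single ℝ (fun _ : V => Mm d) v

noncomputable def vec (P : Prm V E d) (e : E) : V → Mm d :=
  sgn (ends e).1 (ends e).2 (qV R ends P e)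

noncomputable def rV (P : Prm V E d) (w : V) : Nn d := rr (w ∈ R) (P.1 w)

lemma rV_fst (P : Prm V E d) (e : E) : rV R P (ends e).1 (qV R ends P e) = 0 :=
  rr_wdg _ (Or.inl (pt_onU _ _ _))

lemma rV_snd (P : Prm V E d) (e : E) : rV R P (ends e).2 (qV R ends P e) = 0 :=
  rr_wdg _ (Or.inr (pt_onU _ _ _))

lemma LP_dot {X : Type*} [AddCommGroup X] [Module ℝ X] {f g : X → Wd d}
    (hf : ∀ c, LP (fun x => f x c)) (hg : ∀ c, LP (fun x => g x c)) :
    LP (fun x => f x ⬝ᵥ g x) :=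
  LP.sum _ fun i _ => (hf i).mul (hg i)

lemma LP_pt {X : Type*} [AddCommGroup X] [Module ℝ X] (b : Prop) {f : X → Fin 2 → Wd d}
    {z : X → Fin 3 → Wd d}
    (hf : ∀ i c, LP (fun x => f x i c)) (hz : ∀ i c, LP (fun x => z x i c)) (c : Fin (d + 1)) :
    LP (fun x => pt b (f x) (z x) c) := by
  by_cases hb : b
  · simp only [pt, hb, if_true, tri, Pi.add_apply, Pi.smul_apply, smul_eq_mul]
    have hbr : ∀ i j, LP (fun x => br (f x) (z x i) (z x j)) := by
      intro i j
      exact ((LP_dot (hf 0) (hz i)).mul (LP_dot (hf 1) (hz j))).sub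
        ((LP_dot (hf 0) (hz j)).mul (LP_dot (hf 1) (hz i)))
    exact (((hbr 1 2).mul (hz 0 c)).add ((hbr 2 0).mul (hz 1 c))).add ((hbr 0 1).mul (hz 2 c))
  · simp only [pt, hb, if_false]
    exact hz 0 c

lemma LP_frame (v : V) (i : Fin 2) (c : Fin (d + 1)) : LP (fun P : Prm V E d => P.1 v i c) :=
  LP.lin ((LinearMap.proj c : (Wd d) →ₗ[ℝ] ℝ) ∘ₗ (LinearMap.proj i : (Fin 2 → Wd d) →ₗ[ℝ] Wd d) ∘ₗ
    (LinearMap.proj v : (V → Fin 2 → Wd d) →ₗ[ℝ] _) ∘ₗ LinearMap.fst ℝ _ (E → Fin 2 → Fin 3 → Wd d))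

lemma LP_edge (e : E) (k : Fin 2) (i : Fin 3) (c : Fin (d + 1)) :
    LP (fun P : Prm V E d => P.2 e k i c) :=
  LP.lin ((LinearMap.proj c : (Wd d) →ₗ[ℝ] ℝ) ∘ₗ (LinearMap.proj i : (Fin 3 → Wd d) →ₗ[ℝ] Wd d) ∘ₗ
    (LinearMap.proj k : (Fin 2 → Fin 3 → Wd d) →ₗ[ℝ] _) ∘ₗ
    (LinearMap.proj e : (E → Fin 2 → Fin 3 → Wd d) →ₗ[ℝ] _) ∘ₗ
      LinearMap.snd ℝ (V → Fin 2 → Wd d) _)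

lemma LPv_qV (e : E) : LPv (fun P : Prm V E d => qV R ends P e) := by
  apply LPv.pi
  intro p
  simp only [qV, wdg_apply]
  have ha : ∀ c, LP (fun P : Prm V E d => aV R ends P e c) := fun c =>
    LP_pt _ (fun i c => LP_frame _ i c) (fun i c => LP_edge _ _ i c) c
  have hb : ∀ c, LP (fun P : Prm V E d => bV R ends P e c) := fun c =>
    LP_pt _ (fun i c => LP_frame _ i c) (fun i c => LP_edge _ _ i c) c
  exact ((ha _).mul (hb _)).sub ((ha _).mul (hb _))

lemma LPv_vec (e : E) : LPv (fun P : Prm V E d => vec R ends P e) :=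
  (LPv_qV R ends e).lin _

def Good (I : Finset E) (P : Prm V E d) : Prop :=
  LinearIndependent ℝ (fun e : {x // x ∈ I} => vec R ends P e.1)

lemma Good_LO (I : Finset E) : LO (fun P : Prm V E d => Good R ends I P) :=
  LPv.LI (fun e => LPv_vec R ends e.1)

end

end Geom
end BRB

namespace BRB

/-! ### Combinatorics -/

section Comb
set_option linter.unusedSectionVars false
variable {V E : Type} [DecidableEq V] [DecidableEq E]

def ge (D : ℕ) (R : Finset V) (U : Finset V) : ℤ := D * U.card - D - (U ∩ R).card

def eU (ends : E → V × V) (I : Finset E) (U : Finset V) : Finset E :=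
  I.filter fun e => (ends e).1 ∈ U ∧ (ends e).2 ∈ U

def Sp (D : ℕ) (R : Finset V) (ends : E → V × V) (I : Finset E) : Prop :=
  ∀ U : Finset V, 2 ≤ U.card → ((eU ends I U).card : ℤ) ≤ ge D R U

def inc (ends : E → V × V) (I : Finset E) (v : V) : Finset E :=
  I.filter fun e => (ends e).1 = v ∨ (ends e).2 = v

def nbr (ends : E → V × V) (I : Finset E) (v : V) : Finset V := (VF ends (inc ends I v)).erase v

variable {D : ℕ} {R : Finset V} {ends : E → V × V}

lemma mem_VF {F : Finset E} {w : V} : w ∈ VF ends F ↔ ∃ e ∈ F, (ends e).1 = w ∨ (ends e).2 = w := by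
  simp only [VF, Finset.mem_union, Finset.mem_image]
  grind

lemma ge_mod (A B : Finset V) : ge D R A + ge D R B = ge D R (A ∪ B) + ge D R (A ∩ B) := by
  have h1 := Finset.card_union_add_card_inter A B
  have h2 := Finset.card_union_add_card_inter (A ∩ R) (B ∩ R)
  rw [← Finset.union_inter_distrib_right, ← Finset.inter_inter_distrib_right] at h2
  unfold ge
  zify at h1 h2
  linear_combination (-(D:ℤ)) * h1 + h2

lemma ge_nonneg (hD : 4 ≤ D) {U : Finset V} (hU : 2 ≤ U.card) : 0 ≤ ge D R U := by
  have : (U ∩ R).card ≤ U.card := Finset.card_le_card Finset.inter_subset_left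
  unfold ge
  zify at hD hU this
  nlinarith

lemma ge_insert {U : Finset V} {v : V} (hv : v ∉ U) :
    ge D R (insert v U) = ge D R U + D - (if v ∈ R then 1 else 0) := by
  unfold ge
  rw [Finset.card_insert_of_notMem hv]
  split_ifs with h
  · rw [Finset.insert_inter_of_mem h, Finset.card_insert_of_notMem (by simp [hv])]
    push_cast; ring
  · rw [Finset.insert_inter_of_notMem h]
    push_cast; ring

lemma ge_mono (hD : 4 ≤ D) {A B : Finset V} (h : A ⊆ B) : ge D R A ≤ ge D R B := by
  have h1 := Finset.card_sdiff_add_card_eq_card h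
  have h2 : (B ∩ R).card ≤ (A ∩ R).card + (B \ A).card := by
    rw [← Finset.card_sdiff_add_card_eq_card (Finset.inter_subset_inter_right h : A ∩ R ⊆ B ∩ R)]
    have : ((B ∩ R) \ (A ∩ R)).card ≤ (B \ A).card := Finset.card_le_card (by grind)
    omega
  unfold ge
  zify at h1 h2 hD
  have : (0:ℤ) ≤ (B \ A).card := by positivity
  nlinarith

lemma eU_super (I : Finset E) (A B : Finset V) :
    (eU ends I A).card + (eU ends I B).card ≤
      (eU ends I (A ∪ B)).card + (eU ends I (A ∩ B)).card := by
  rw [← Finset.card_union_add_card_inter]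
  apply add_le_add <;> apply Finset.card_le_card <;> intro e <;> simp [eU] <;> tauto

lemma eU_single {I : Finset E} (hl : ∀ e ∈ I, (ends e).1 ≠ (ends e).2) (w : V) :
    (eU ends I {w}).card = 0 := by
  rw [Finset.card_eq_zero, eU, Finset.filter_eq_empty_iff]
  intro e he
  have := hl e he
  simp
  grind

lemma tight_union {I : Finset E} (hl : ∀ e ∈ I, (ends e).1 ≠ (ends e).2) (hI : Sp D R ends I)
    {A B : Finset V} (hA2 : 2 ≤ A.card) (hA : ((eU ends I A).card : ℤ) = ge D R A)
    (hB : ((eU ends I B).card : ℤ) = ge D R B)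
    (h : 2 ≤ (A ∩ B).card ∨ ∃ w, w ∉ R ∧ A ∩ B = {w}) :
    ((eU ends I (A ∪ B)).card : ℤ) = ge D R (A ∪ B) := by
  have h1 := eU_super (ends := ends) I A B
  have h2 := ge_mod (D := D) (R := R) A B
  have h3 : ((eU ends I (A ∪ B)).card : ℤ) ≤ ge D R (A ∪ B) :=
    hI _ (hA2.trans (Finset.card_le_card Finset.subset_union_left))
  have h4 : ((eU ends I (A ∩ B)).card : ℤ) ≤ ge D R (A ∩ B) := by
    rcases h with h | ⟨w, hw, h⟩
    · exact hI _ h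
    · rw [h, eU_single hl]
      simp [ge, hw]
  zify at h1
  linarith

lemma exists_pair (hD : 4 ≤ D) [Fintype V] {I : Finset E}
    (hl : ∀ e ∈ I, (ends e).1 ≠ (ends e).2) (hI : Sp D R ends I) (N : Finset V) (hN : 2 ≤ N.card)
    (hno : ∀ U : Finset V, 2 ≤ U.card → ((eU ends I U).card : ℤ) = ge D R U → ¬ N ⊆ U) :
    ∃ a ∈ N, ∃ b ∈ N, a ≠ b ∧ ∀ U : Finset V, a ∈ U → b ∈ U →
      ((eU ends I U).card : ℤ) < ge D R U := by
  by_contra hcon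
  push Not at hcon
  have hpair : ∀ a ∈ N, ∀ b ∈ N, a ≠ b → ∃ U : Finset V, a ∈ U ∧ b ∈ U ∧ 2 ≤ U.card ∧
      ((eU ends I U).card : ℤ) = ge D R U := by
    intro a ha b hb hab
    obtain ⟨U, h1, h2, h3⟩ := hcon a ha b hb hab
    have : 2 ≤ U.card := Finset.one_lt_card.2 ⟨a, h1, b, h2, hab⟩
    exact ⟨U, h1, h2, this, le_antisymm (hI U this) h3⟩
  let S : Finset (Finset V) := Finset.univ.filter fun U =>
    2 ≤ (U ∩ N).card ∧ ((eU ends I U).card : ℤ) = ge D R U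
  have hSne : S.Nonempty := by
    obtain ⟨a, ha, b, hb, hab⟩ := Finset.one_lt_card.1 hN
    obtain ⟨U, h1, h2, h3, h4⟩ := hpair a ha b hb hab
    refine ⟨U, ?_⟩
    simp only [S, Finset.mem_filter, Finset.mem_univ, true_and]
    exact ⟨Finset.one_lt_card.2 ⟨a, by simp [*], b, by simp [*], hab⟩, h4⟩
  obtain ⟨U1, hU1, hmax⟩ := S.exists_max_image Finset.card hSne
  simp only [S, Finset.mem_filter, Finset.mem_univ, true_and] at hU1 hmax
  obtain ⟨h12, ht1⟩ := hU1
  have hU12 : 2 ≤ U1.card := h12.trans (Finset.card_le_card Finset.inter_subset_left)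
  have hN1 := hno U1 hU12 ht1
  rw [Finset.not_subset] at hN1
  obtain ⟨w3, hw3, hw3U⟩ := hN1
  -- meeting in a rod vertex only
  have meet : ∀ w ∈ U1, w ∈ N → ∀ U : Finset V, w ∈ U → w3 ∈ U →
      ((eU ends I U).card : ℤ) = ge D R U → U1 ∩ U = {w} ∧ w ∈ R := by
    intro w hw hwN U hwU h3U htU
    have hnot : ¬ (2 ≤ (U1 ∩ U).card ∨ ∃ w, w ∉ R ∧ U1 ∩ U = {w}) := by
      intro h
      have ht := tight_union hl hI hU12 ht1 htU h
      have := hmax (U1 ∪ U) ⟨h12.trans (Finset.card_le_card (by grind)), ht⟩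
      have : U1.card < (U1 ∪ U).card := Finset.card_lt_card (by
        rw [Finset.ssubset_iff_of_subset Finset.subset_union_left]
        exact ⟨w3, by simp [h3U], hw3U⟩)
      omega
    push Not at hnot
    have hm : w ∈ U1 ∩ U := by simp [hw, hwU]
    have h1 : (U1 ∩ U) = {w} := by
      have hc : (U1 ∩ U).card = 1 := by
        have := Finset.card_pos.2 ⟨w, hm⟩
        omega
      obtain ⟨x, hx⟩ := Finset.card_eq_one.1 hc
      rw [hx] at hm ⊢
      simp at hm
      rw [hm]
    refine ⟨h1, ?_⟩
    by_contra hR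
    exact hnot.2 w hR h1
  obtain ⟨w1, hw1, w2, hw2, hw12⟩ := Finset.one_lt_card.1 h12
  rw [Finset.mem_inter] at hw1 hw2
  have n13 : w1 ≠ w3 := by rintro rfl; exact hw3U hw1.1
  have n23 : w2 ≠ w3 := by rintro rfl; exact hw3U hw2.1
  obtain ⟨A, hA1, hA3, hA2, hAt⟩ := hpair w1 hw1.2 w3 hw3 n13
  obtain ⟨B, hB2, hB3, hB22, hBt⟩ := hpair w2 hw2.2 w3 hw3 n23
  obtain ⟨e1, r1⟩ := meet w1 hw1.1 hw1.2 A hA1 hA3 hAt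
  obtain ⟨e2, r2⟩ := meet w2 hw2.1 hw2.2 B hB2 hB3 hBt
  have hAB : A ∩ B = {w3} := by
    have hnot : ¬ (2 ≤ (A ∩ B).card ∨ ∃ w, w ∉ R ∧ A ∩ B = {w}) := by
      intro h
      have ht := tight_union hl hI hA2 hAt hBt h
      have := (meet w1 hw1.1 hw1.2 (A ∪ B) (by simp [hA1]) (by simp [hA3]) ht).1
      have hh : w2 ∈ U1 ∩ (A ∪ B) := by simp [hw2.1, hB2]
      rw [this] at hh
      simp at hh
      exact hw12 hh.symm
    push Not at hnot
    have hm : w3 ∈ A ∩ B := by simp [hA3, hB3]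
    have hc : (A ∩ B).card = 1 := by
      have := Finset.card_pos.2 ⟨w3, hm⟩
      omega
    obtain ⟨x, hx⟩ := Finset.card_eq_one.1 hc
    rw [hx] at hm ⊢
    simp at hm
    rw [hm]
  -- counting
  have hsum : (eU ends I U1).card + (eU ends I A).card + (eU ends I B).card ≤
      (eU ends I (U1 ∪ A ∪ B)).card := by
    have d1 : Disjoint (eU ends I U1) (eU ends I A) := by
      rw [Finset.disjoint_left]
      intro e h1 h2
      simp only [eU, Finset.mem_filter] at h1 h2
      have a1 : (ends e).1 ∈ U1 ∩ A := by grind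
      have a2 : (ends e).2 ∈ U1 ∩ A := by grind
      rw [e1, Finset.mem_singleton] at a1 a2
      exact hl e h1.1 (a1.trans a2.symm)
    have d2 : Disjoint (eU ends I U1 ∪ eU ends I A) (eU ends I B) := by
      rw [Finset.disjoint_left]
      intro e h1 h2
      simp only [eU, Finset.mem_filter, Finset.mem_union] at h1 h2
      rcases h1 with h1 | h1
      · have a1 : (ends e).1 ∈ U1 ∩ B := by grind
        have a2 : (ends e).2 ∈ U1 ∩ B := by grind
        rw [e2, Finset.mem_singleton] at a1 a2
        exact hl e h1.1 (a1.trans a2.symm)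
      · have a1 : (ends e).1 ∈ A ∩ B := by grind
        have a2 : (ends e).2 ∈ A ∩ B := by grind
        rw [hAB, Finset.mem_singleton] at a1 a2
        exact hl e h1.1 (a1.trans a2.symm)
    rw [← Finset.card_union_of_disjoint d1, ← Finset.card_union_of_disjoint d2]
    apply Finset.card_le_card
    intro e
    simp only [eU, Finset.mem_filter, Finset.mem_union]
    tauto
  have m1 := ge_mod (D := D) (R := R) U1 A
  have m2 := ge_mod (D := D) (R := R) (U1 ∪ A) B
  have e3 : (U1 ∪ A) ∩ B = {w2, w3} := by
    rw [Finset.union_inter_distrib_right, e2, hAB]; rfl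
  rw [e1] at m1
  rw [e3] at m2
  have s1 : ge D R {w1} = -1 := by simp [ge, r1]
  have s2 : (D:ℤ) - 2 ≤ ge D R {w2, w3} := by
    have : (({w2, w3} : Finset V) ∩ R).card ≤ 2 :=
      (Finset.card_le_card Finset.inter_subset_left).trans Finset.card_le_two
    unfold ge
    rw [Finset.card_pair n23]
    zify at this
    push_cast
    linarith
  have h3 := hI (U1 ∪ A ∪ B) (hU12.trans (Finset.card_le_card (by grind)))
  zify at hsum hD
  linarith

lemma mem_nbr {I : Finset E} {v w : V} :
    w ∈ nbr ends I v ↔ w ≠ v ∧ ∃ e ∈ I, ((ends e).1 = v ∨ (ends e).2 = v) ∧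
      ((ends e).1 = w ∨ (ends e).2 = w) := by
  simp only [nbr, Finset.mem_erase, mem_VF, inc, Finset.mem_filter, and_assoc]

lemma add_edge {I : Finset E} (hI : Sp D R ends I) (e : E)
    (h : ∀ U : Finset V, (ends e).1 ∈ U → (ends e).2 ∈ U → ((eU ends I U).card : ℤ) < ge D R U) :
    Sp D R ends (insert e I) := by
  intro U hU
  have h1 := hI U hU
  by_cases hc : (ends e).1 ∈ U ∧ (ends e).2 ∈ U
  · have h2 := h U hc.1 hc.2
    have h3 : (eU ends (insert e I) U).card ≤ (eU ends I U).card + 1 := by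
      refine le_trans (Finset.card_le_card ?_) (Finset.card_insert_le e (eU ends I U))
      intro x; simp [eU]; tauto
    zify at h3
    linarith
  · have : eU ends (insert e I) U = eU ends I U := by
      simp [eU, Finset.filter_insert, hc]
    rw [this]; exact h1

lemma Sp.mono {I J : Finset E} (hI : Sp D R ends I) (h : J ⊆ I) : Sp D R ends J := by
  intro U hU
  refine le_trans ?_ (hI U hU)
  exact_mod_cast Finset.card_le_card (Finset.filter_subset_filter _ h)

lemma inc_pair_le {I : Finset E} (hI : Sp D R ends I) {v w : V} (hvw : v ≠ w) :
    (((inc ends I v).filter fun e => (ends e).1 = w ∨ (ends e).2 = w).card : ℤ) ≤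
      D - (if v ∈ R then 1 else 0) - (if w ∈ R then 1 else 0) := by
  have h := hI {v, w} (by rw [Finset.card_pair hvw])
  rw [ge_insert (by simpa using hvw)] at h
  have h2 : ge D R {w} = - (if w ∈ R then 1 else 0) := by
    by_cases hw : w ∈ R <;> simp [ge, hw]
  rw [h2] at h
  have h3 : ((inc ends I v).filter fun e => (ends e).1 = w ∨ (ends e).2 = w).card ≤
      (eU ends I {v, w}).card := by
    apply Finset.card_le_card
    intro e
    simp only [inc, eU, Finset.mem_filter, Finset.mem_insert, Finset.mem_singleton]
    grind
  zify at h3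
  linarith

lemma deg_le_of_nbr {I : Finset E} (hl : ∀ e ∈ I, (ends e).1 ≠ (ends e).2) (hI : Sp D R ends I)
    {v w : V} (hvw : v ≠ w) (hN : nbr ends I v ⊆ {w}) :
    ((inc ends I v).card : ℤ) ≤ D - (if v ∈ R then 1 else 0) - (if w ∈ R then 1 else 0) := by
  refine le_trans ?_ (inc_pair_le hI hvw)
  norm_cast
  apply Finset.card_le_card
  intro e he
  rw [Finset.mem_filter]
  refine ⟨he, ?_⟩
  simp only [inc, Finset.mem_filter] at he
  have hle := hl e he.1
  rcases he.2 with h | h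
  · have := hN (mem_nbr.2 ⟨by rw [← h]; exact hle.symm, e, he.1, he.2, Or.inr rfl⟩)
    right; simpa using this
  · have := hN (mem_nbr.2 ⟨by rw [← h]; exact hle, e, he.1, he.2, Or.inl rfl⟩)
    left; simpa using this

lemma third_nbr {I : Finset E} (hl : ∀ e ∈ I, (ends e).1 ≠ (ends e).2) (hI : Sp D R ends I)
    {v i j : V} (hv : v ∈ R) (hi : i ∈ R) (hj : j ∈ R)
    (hd : 2 * D ≤ (inc ends I v).card + 3) (hD : 4 ≤ D) : ∃ l ∈ nbr ends I v, l ≠ i ∧ l ≠ j := by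
  by_contra hcon
  push Not at hcon
  have hb : ∀ w ∈ R, ((inc ends I v).filter fun e =>
      w ≠ v ∧ ((ends e).1 = w ∨ (ends e).2 = w)).card + 2 ≤ D := by
    intro w hw
    by_cases hvw : v = w
    · simp [hvw]; omega
    · have := inc_pair_le hI hvw
      simp only [hv, hw, if_true] at this
      have e : ((inc ends I v).filter fun e =>
        w ≠ v ∧ ((ends e).1 = w ∨ (ends e).2 = w)) = ((inc ends I v).filter fun e =>
        ((ends e).1 = w ∨ (ends e).2 = w)) := by
        apply Finset.filter_congr; intro e _; simp [Ne.symm hvw]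
      rw [e]
      omega
  have h1 := hb i hi
  have h2 := hb j hj
  have h3 : inc ends I v ⊆ ((inc ends I v).filter fun e =>
      i ≠ v ∧ ((ends e).1 = i ∨ (ends e).2 = i)) ∪ ((inc ends I v).filter fun e =>
      j ≠ v ∧ ((ends e).1 = j ∨ (ends e).2 = j)) := by
    intro e he
    have he' := he
    simp only [inc, Finset.mem_filter] at he
    have hle := hl e he.1
    have : ∃ w ∈ nbr ends I v, (ends e).1 = w ∨ (ends e).2 = w := by
      rcases he.2 with h | h
      · exact ⟨(ends e).2, mem_nbr.2 ⟨by rw [← h]; exact hle.symm, e, he.1, he.2, Or.inr rfl⟩, by simp⟩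
      · exact ⟨(ends e).1, mem_nbr.2 ⟨by rw [← h]; exact hle, e, he.1, he.2, Or.inl rfl⟩, by simp⟩
    obtain ⟨w, hw, hw'⟩ := this
    have hwv := (mem_nbr.1 hw).1
    rw [Finset.mem_union, Finset.mem_filter, Finset.mem_filter]
    by_cases hwi : w = i
    · left; subst hwi; exact ⟨he', hwv, hw'⟩
    · right
      have := hcon w hw hwi
      subst this; exact ⟨he', hwv, hw'⟩
  have h4 := (Finset.card_le_card h3).trans (Finset.card_union_le _ _)
  omega

lemma lemC (hD : 4 ≤ D) [Fintype V] (hfresh : ∀ (a b : V) (s : Finset E), ∃ e ∉ s, ends e = (a, b))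
    {I : Finset E} (hl : ∀ e ∈ I, (ends e).1 ≠ (ends e).2) (hI : Sp D R ends I) (v : V) (s : ℕ)
    (hs : (s:ℤ) ≤ ((inc ends I v).card : ℤ) + (if v ∈ R then 1 else 0) - D ∨ s = 0) :
    ∃ K : Finset E, K.card = s ∧ Disjoint K I ∧
      (∀ e ∈ K, (ends e).1 ∈ nbr ends I v ∧ (ends e).2 ∈ nbr ends I v ∧ (ends e).1 ≠ (ends e).2) ∧
      Sp D R ends ((I \ inc ends I v) ∪ K) := by
  induction s with
  | zero =>
    exact ⟨∅, by simp, by simp, by simp, by simpa using hI.mono Finset.sdiff_subset⟩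
  | succ s ih =>
    have hs' : (s:ℤ) + 1 ≤ ((inc ends I v).card : ℤ) + (if v ∈ R then 1 else 0) - D := by
      rcases hs with h | h
      · exact_mod_cast h
      · omega
    obtain ⟨K, hKc, hKd, hKe, hKS⟩ := ih (Or.inl (by linarith))
    have hv1 : (if v ∈ R then (1:ℤ) else 0) ≤ 1 ∧ 0 ≤ (if v ∈ R then (1:ℤ) else 0) := by
      split_ifs <;> simp
    have hN2 : 2 ≤ (nbr ends I v).card := by
      by_contra hlt
      have hc : (nbr ends I v).card ≤ 1 := by omega
      haveI : Nonempty V := ⟨v⟩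
      rcases Finset.card_le_one_iff_subset_singleton.1 hc with ⟨w, hw⟩
      have hd : ((inc ends I v).card : ℤ) ≤ D - (if v ∈ R then 1 else 0) := by
        by_cases hvw : v = w
        · have : inc ends I v = ∅ := by
            rw [Finset.eq_empty_iff_forall_notMem]
            intro e he
            simp only [inc, Finset.mem_filter] at he
            have hle := hl e he.1
            rcases he.2 with h | h
            · have := hw (mem_nbr.2 ⟨by rw [← h]; exact hle.symm, e, he.1, he.2, Or.inr rfl⟩)
              simp at this
              exact hle (by rw [h, this, hvw])
            · have := hw (mem_nbr.2 ⟨by rw [← h]; exact hle, e, he.1, he.2, Or.inl rfl⟩)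
              simp at this
              exact hle (by rw [h, this, hvw])
          rw [this]
          simp
          zify at hD
          linarith
        · have := deg_le_of_nbr hl hI hvw hw
          have h0 : 0 ≤ (if w ∈ R then (1:ℤ) else 0) := by split_ifs <;> simp
          linarith
      have : (0:ℤ) ≤ s := by positivity
      linarith
    have hl' : ∀ e ∈ (I \ inc ends I v) ∪ K, (ends e).1 ≠ (ends e).2 := by
      intro e he
      rw [Finset.mem_union, Finset.mem_sdiff] at he
      rcases he with he | he
      · exact hl e he.1
      · exact (hKe e he).2.2
    obtain ⟨a, ha, b, hb, hab, hU⟩ := exists_pair hD hl' hKS (nbr ends I v) hN2 (by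
      intro U hU2 ht hNU
      have hle : (eU ends ((I \ inc ends I v) ∪ K) U).card + (inc ends I v).card ≤
          (eU ends I (insert v U)).card + s := by
        have h1 : eU ends ((I \ inc ends I v) ∪ K) U ⊆ eU ends (I \ inc ends I v) U ∪ K := by
          intro e; simp only [eU, Finset.mem_filter, Finset.mem_union]; tauto
        have h2 := (Finset.card_le_card h1).trans (Finset.card_union_le _ _)
        have h3 : Disjoint (eU ends (I \ inc ends I v) U) (inc ends I v) := by
          rw [Finset.disjoint_left]
          intro e he
          simp only [eU, Finset.mem_filter, Finset.mem_sdiff] at he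
          exact he.1.2
        have h4 : eU ends (I \ inc ends I v) U ∪ inc ends I v ⊆ eU ends I (insert v U) := by
          intro e he
          rw [Finset.mem_union] at he
          rcases he with he | he
          · simp only [eU, Finset.mem_filter, Finset.mem_sdiff, Finset.mem_insert] at he ⊢
            tauto
          · simp only [inc, Finset.mem_filter] at he
            simp only [eU, Finset.mem_filter, Finset.mem_insert]
            have hle := hl e he.1
            refine ⟨he.1, ?_⟩
            rcases he.2 with h | h
            · exact ⟨Or.inl h, Or.inr (hNU (mem_nbr.2 ⟨by rw [← h]; exact hle.symm, e, he.1, he.2, Or.inr rfl⟩))⟩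
            · exact ⟨Or.inr (hNU (mem_nbr.2 ⟨by rw [← h]; exact hle, e, he.1, he.2, Or.inl rfl⟩)), Or.inl h⟩
        have h5 := Finset.card_le_card h4
        rw [Finset.card_union_of_disjoint h3] at h5
        omega
      have h6 := hI (insert v U) (hU2.trans (Finset.card_le_card (Finset.subset_insert _ _)))
      zify at hle hD
      by_cases hvU : v ∈ U
      · rw [Finset.insert_eq_of_mem hvU] at h6 hle
        linarith
      · rw [ge_insert hvU] at h6
        linarith)
    obtain ⟨e, he, hee⟩ := hfresh a b (K ∪ I)
    rw [Finset.mem_union, not_or] at he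
    refine ⟨insert e K, by rw [Finset.card_insert_of_notMem he.1, hKc], ?_, ?_, ?_⟩
    · rw [Finset.disjoint_insert_left]; exact ⟨he.2, hKd⟩
    · intro f hf
      rw [Finset.mem_insert] at hf
      rcases hf with rfl | hf
      · rw [hee]; exact ⟨ha, hb, hab⟩
      · exact hKe f hf
    · rw [Finset.union_insert]
      exact add_edge hKS e (by rw [hee]; exact hU)

lemma exists_low [Fintype V] (hD : 4 ≤ D) {I : Finset E} (hl : ∀ e ∈ I, (ends e).1 ≠ (ends e).2)
    (hI : Sp D R ends I) (hne : I.Nonempty) :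
    ∃ v ∈ VF ends I, (inc ends I v).card + 2 * (if v ∈ R then 1 else 0) + 1 ≤ 2 * D := by
  by_contra hcon
  push Not at hcon
  have h2 : 2 ≤ (VF ends I).card := by
    obtain ⟨e, he⟩ := hne
    exact Finset.one_lt_card.2 ⟨_, mem_VF.2 ⟨e, he, Or.inl rfl⟩, _, mem_VF.2 ⟨e, he, Or.inr rfl⟩,
      hl e he⟩
  have hs := hI _ h2
  have hfull : eU ends I (VF ends I) = I := by
    apply Finset.filter_true_of_mem
    intro e he
    exact ⟨mem_VF.2 ⟨e, he, Or.inl rfl⟩, mem_VF.2 ⟨e, he, Or.inr rfl⟩⟩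
  rw [hfull] at hs
  have h3 : ∑ v ∈ VF ends I, (inc ends I v).card ≤ 2 * I.card := by
    have a1 := Finset.card_eq_sum_card_fiberwise (s := I) (t := VF ends I) (f := fun e => (ends e).1)
      (fun e he => mem_VF.2 ⟨e, he, Or.inl rfl⟩)
    have a2 := Finset.card_eq_sum_card_fiberwise (s := I) (t := VF ends I) (f := fun e => (ends e).2)
      (fun e he => mem_VF.2 ⟨e, he, Or.inr rfl⟩)
    have a3 : 2 * I.card = ∑ v ∈ VF ends I, ((I.filter fun e => (ends e).1 = v).card +
        (I.filter fun e => (ends e).2 = v).card) := by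
      rw [Finset.sum_add_distrib, ← a1, ← a2, two_mul]
    rw [a3]
    apply Finset.sum_le_sum
    intro v _
    rw [inc, Finset.filter_or]
    exact Finset.card_union_le _ _
  have h4 : ∑ v ∈ VF ends I, (if v ∈ R then 1 else 0) = (VF ends I ∩ R).card := by
    rw [Finset.sum_boole, Finset.filter_mem_eq_inter]; simp
  have h5 : ∑ v ∈ VF ends I, 2 * D ≤ ∑ v ∈ VF ends I, ((inc ends I v).card + 2 * (if v ∈ R then 1 else 0)) :=
    Finset.sum_le_sum fun v hv => by have := hcon v hv; omega
  rw [Finset.sum_add_distrib, ← Finset.mul_sum (VF ends I) (fun v => if v ∈ R then 1 else 0), h4,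
    Finset.sum_const, smul_eq_mul] at h5
  unfold ge at hs
  have h6 : (VF ends I).card * (2 * D) ≤ 2 * I.card + 2 * (VF ends I ∩ R).card := by omega
  zify at h6 hD
  nlinarith

lemma Sp_of_count (hD : 4 ≤ D) {I : Finset E}
    (h : ∀ F ⊆ I, F.Nonempty →
      (F.card : ℤ) ≤ D * (VF ends F).card - D - ((VF ends F) ∩ R).card) : Sp D R ends I := by
  intro U hU
  rcases (eU ends I U).eq_empty_or_nonempty with h0 | h0
  · rw [h0]; simpa using ge_nonneg hD hU
  · refine (h _ (Finset.filter_subset _ _) h0).trans ?_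
    apply ge_mono hD
    intro w hw
    obtain ⟨e, he, h⟩ := mem_VF.1 hw
    have := (Finset.mem_filter.1 he).2
    grind

end Comb
end BRB

namespace BRB
open Module

/-! ### Endgame -/

section EL
variable {W N V : Type*} [AddCommGroup W] [Module ℝ W] [AddCommGroup N] [Module ℝ N]

lemma ind_mk {a b k l : N} (h : LinearIndependent ℝ ![a, b, k, l]) :
    LinearIndependent ℝ ![(Submodule.span ℝ {k, l}).mkQ a, (Submodule.span ℝ {k, l}).mkQ b] := by
  rw [LinearIndependent.pair_iff]
  intro s t hst
  rw [← map_smul, ← map_smul, ← map_add, Submodule.mkQ_apply, Submodule.Quotient.mk_eq_zero,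
    Submodule.mem_span_pair] at hst
  obtain ⟨p, q, hpq⟩ := hst
  rw [Fintype.linearIndependent_iff] at h
  have h2 := h ![s, t, -p, -q] (by
    simp only [Fin.sum_univ_four]
    simp
    have : s • a + t • b + -(p • k) + -(q • l) = (s • a + t • b) - (p • k + q • l) := by abel
    rw [this, hpq, sub_self])
  have h0 := h2 0
  have h1 := h2 1
  simp at h0 h1
  exact ⟨h0, h1⟩

lemma EL_step (β : W →ₗ[ℝ] W →ₗ[ℝ] N)
    (hspan : ∀ S : Submodule ℝ N, (∀ ξ η, β ξ η ∈ S) → S = ⊤)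
    (C : Submodule ℝ (V → N)) (r ρ : V → N) (hr : ∀ w, r w = ρ w ∨ r w = 0)
    (G : W × W → Prop) (hGO : LO G) (hGne : ∃ x, G x)
    (i j l : V)
    (hG : ∀ p, G p → ∃ x ∈ C, x ≠ 0 ∧ ∃ (a : N) (s μ : V → ℝ), ∀ w, (w = i ∨ w = j ∨ w = l) →
      x w + s w • r w = a + μ w • β p.1 p.2)
    (hinj : ∀ x ∈ C, ∀ s t : ℝ, x i - x j + s • r i - t • r j = 0 → x = 0 ∧ s = 0 ∧ t = 0)
    (hsurj : ∀ n, ∃ x ∈ C, ∃ s t : ℝ, x i - x j + s • r i - t • r j = n)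
    (ξ η : W) (hρ : ρ j = β ξ η)
    (g2 : ∃ η', LinearIndependent ℝ ![β ξ η', ρ j, ρ i, ρ l])
    (g3 : ∃ ξ' η', LinearIndependent ℝ ![β ξ' η', β ξ η', ρ i, ρ l]) :
    ∀ x ∈ C, x l - x i ∈ Submodule.span ℝ {ρ i, ρ l} := by
  have hrj : r j = ρ j := by
    rcases hr j with h | h
    · exact h
    · have := hinj 0 C.zero_mem 0 1 (by simp [h])
      simp at this
  set K := Submodule.span ℝ {ρ i, ρ l} with hK
  have hrK : ∀ w, (w = i ∨ w = l) → r w ∈ K := by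
    intro w hw
    rcases hr w with h | h
    · rw [h]
      apply Submodule.subset_span
      rcases hw with rfl | rfl <;> simp
    · rw [h]; exact K.zero_mem
  let Φ : (C × ℝ × ℝ) →ₗ[ℝ] N :=
    LinearMap.coprod (((LinearMap.proj i : (V → N) →ₗ[ℝ] N) - LinearMap.proj j) ∘ₗ C.subtype)
      (LinearMap.coprod (LinearMap.toSpanSingleton ℝ N (r i))
        (- LinearMap.toSpanSingleton ℝ N (r j)))
  have hΦ : ∀ x s t, Φ (x, s, t) = x.1 i - x.1 j + s • r i - t • r j := by
    intro x s t
    simp [Φ, sub_eq_add_neg, add_assoc]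
  have hbij : Function.Bijective Φ := by
    constructor
    · rw [← LinearMap.ker_eq_bot, LinearMap.ker_eq_bot']
      rintro ⟨x, s, t⟩ h
      rw [hΦ] at h
      obtain ⟨h1, h2, h3⟩ := hinj x.1 x.2 s t h
      ext1
      · exact Subtype.ext h1
      · simp [h2, h3]
    · intro n
      obtain ⟨x, hx, s, t, h⟩ := hsurj n
      exact ⟨(⟨x, hx⟩, s, t), by rw [hΦ]; exact h⟩
  let e := LinearEquiv.ofBijective Φ hbij
  have he : ∀ y, e.symm (Φ y) = y := fun y => e.symm_apply_apply y
  let Θ : N →ₗ[ℝ] N :=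
    (((LinearMap.proj l : (V → N) →ₗ[ℝ] N) - LinearMap.proj i) ∘ₗ C.subtype ∘ₗ LinearMap.fst ℝ C (ℝ × ℝ)) ∘ₗ
      e.symm.toLinearMap
  have hΘ : ∀ n, Θ n = (e.symm n).1.1 l - (e.symm n).1.1 i := fun n => rfl
  -- claim A
  have hA : ∀ p, G p → ¬ LinearIndependent ℝ ![K.mkQ (β p.1 p.2), K.mkQ (Θ (β p.1 p.2))] := by
    intro p hp hli
    obtain ⟨x, hx, hx0, a, s, μ, h⟩ := hG p hp
    have hi := h i (by simp)
    have hj := h j (by simp)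
    have hl := h l (by simp)
    have e1 : Φ (⟨x, hx⟩, s i, s j) = (μ i - μ j) • β p.1 p.2 := by
      rw [hΦ]
      have : x i - x j + s i • r i - s j • r j = (x i + s i • r i) - (x j + s j • r j) := by abel
      simp only [this, hi, hj]
      module
    have hc : μ i - μ j ≠ 0 := by
      intro h0
      rw [h0, zero_smul, hΦ] at e1
      exact hx0 (hinj x hx _ _ e1).1
    have e2 : (μ i - μ j) • Θ (β p.1 p.2) = x l - x i := by
      rw [← map_smul, ← e1, hΘ, he]
    have e3 : (μ i - μ j) • K.mkQ (Θ (β p.1 p.2)) = (μ l - μ i) • K.mkQ (β p.1 p.2) := by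
      rw [← map_smul, e2, ← map_smul, ← sub_eq_zero, ← map_sub, Submodule.mkQ_apply,
        Submodule.Quotient.mk_eq_zero]
      have : x l - x i - (μ l - μ i) • β p.1 p.2 = s i • r i - s l • r l := by
        have h1 : x l = a + μ l • β p.1 p.2 - s l • r l := by rw [← hl]; abel
        have h2 : x i = a + μ i • β p.1 p.2 - s i • r i := by rw [← hi]; abel
        rw [h1, h2]; module
      rw [this]
      exact K.sub_mem (K.smul_mem _ (hrK _ (by simp))) (K.smul_mem _ (hrK _ (by simp)))
    rw [LinearIndependent.pair_iff] at hli
    have := hli (-(μ l - μ i)) (μ i - μ j) (by rw [e3]; module)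
    exact hc this.2
  have hB : ∀ ξ η, K.mkQ (β ξ η) ≠ 0 → ∃ c : ℝ, K.mkQ (Θ (β ξ η)) = c • K.mkQ (β ξ η) := by
    intro ξ η h0
    by_contra hne
    push Not at hne
    have hli : LinearIndependent ℝ ![K.mkQ (β ξ η), K.mkQ (Θ (β ξ η))] := by
      rw [LinearIndependent.pair_iff' h0]
      exact fun a h => hne a h.symm
    have hLO : LO (fun p : W × W =>
        LinearIndependent ℝ (fun k : Fin 2 => (![fun p : W × W => K.mkQ (β p.1 p.2),
          fun p : W × W => K.mkQ (Θ (β p.1 p.2))] k) p)) := by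
      have hb : LPv (fun p : W × W => β p.1 p.2) := by
        simpa using LPv.bilin β (LinearMap.fst ℝ W W) (LinearMap.snd ℝ W W) 0 0
      apply LPv.LI
      intro k
      fin_cases k
      · exact hb.lin K.mkQ
      · exact hb.lin (K.mkQ ∘ₗ Θ)
    have heq : ∀ p : W × W, (fun k : Fin 2 => (![fun p : W × W => K.mkQ (β p.1 p.2),
          fun p : W × W => K.mkQ (Θ (β p.1 p.2))] k) p) =
          ![K.mkQ (β p.1 p.2), K.mkQ (Θ (β p.1 p.2))] := by
      intro p; funext k; fin_cases k <;> rfl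
    simp only [heq] at hLO
    obtain ⟨p, hp, hp'⟩ := LO.exists_and hGO hLO hGne ⟨(ξ, η), hli⟩
    exact hA p hp hp'
  let Z : Submodule ℝ N := LinearMap.ker (K.mkQ ∘ₗ Θ)
  have hZ : ∀ n, n ∈ Z ↔ K.mkQ (Θ n) = 0 := fun n => Iff.rfl
  have hjZ : ρ j ∈ Z := by
    rw [hZ, ← hrj]
    have : r j = Φ (0, 0, -1) := by rw [hΦ]; simp
    rw [hΘ, this, he]
    simp
  have hC : ∀ ξ₁ η₁ ξ₂ η₂ ξ₃ η₃, β ξ₃ η₃ = β ξ₁ η₁ + β ξ₂ η₂ → β ξ₂ η₂ ∈ Z →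
      LinearIndependent ℝ ![K.mkQ (β ξ₁ η₁), K.mkQ (β ξ₂ η₂)] → β ξ₁ η₁ ∈ Z := by
    intro ξ₁ η₁ ξ₂ η₂ ξ₃ η₃ h3 h2 hli
    rw [LinearIndependent.pair_iff] at hli
    have n1 : K.mkQ (β ξ₁ η₁) ≠ 0 := by
      intro h
      have := hli 1 0 (by simp [h])
      simp at this
    have n3 : K.mkQ (β ξ₃ η₃) ≠ 0 := by
      intro h
      rw [h3, map_add] at h
      have := hli 1 1 (by simpa using h)
      simp at this
    obtain ⟨c, hc⟩ := hB _ _ n1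
    obtain ⟨c', hc'⟩ := hB _ _ n3
    rw [hZ] at h2 ⊢
    rw [h3, map_add, map_add, h2, add_zero, hc, map_add, smul_add] at hc'
    have := hli (c - c') (-c') (by rw [sub_smul, hc']; module)
    have h0 : c = 0 := by linarith [this.1, this.2]
    rw [hc, h0, zero_smul]
  have hD : ∀ η', β ξ η' ∈ Z := by
    obtain ⟨η₀, h0⟩ := g2
    have hLO : LO (fun η' : W =>
        LinearIndependent ℝ (fun k : Fin 2 => (![fun η' : W => K.mkQ (β ξ η'),
          fun η' : W => K.mkQ (ρ j)] k) η')) := by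
      apply LPv.LI
      intro k
      fin_cases k
      · intro φ
        exact LP.lin (φ ∘ₗ K.mkQ ∘ₗ β ξ)
      · exact LPv.const _
    have heq : ∀ η' : W, (fun k : Fin 2 => (![fun η' : W => K.mkQ (β ξ η'),
          fun η' : W => K.mkQ (ρ j)] k) η') = ![K.mkQ (β ξ η'), K.mkQ (ρ j)] := by
      intro p; funext k; fin_cases k <;> rfl
    simp only [heq] at hLO
    refine hLO.span_top ⟨η₀, ind_mk h0⟩ (Z.comap (β ξ)) ?_
    intro η' h
    rw [Submodule.mem_comap]
    rw [hρ] at h hjZ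
    exact hC ξ η' ξ η ξ (η' + η) (by simp) hjZ h
  have hE : ∀ ξ' η', β ξ' η' ∈ Z := by
    obtain ⟨ξ₀, η₀, h0⟩ := g3
    intro ξ' η'
    by_contra hne
    have hb : LPv (fun p : W × W => β p.1 p.2) := by
      simpa using LPv.bilin β (LinearMap.fst ℝ W W) (LinearMap.snd ℝ W W) 0 0
    have hLO : LO (fun p : W × W =>
        LinearIndependent ℝ (fun k : Fin 2 => (![fun p : W × W => K.mkQ (β p.1 p.2),
          fun p : W × W => K.mkQ (β ξ p.2)] k) p)) := by
      apply LPv.LI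
      intro k
      fin_cases k
      · exact hb.lin K.mkQ
      · intro φ
        exact LP.lin (φ ∘ₗ K.mkQ ∘ₗ β ξ ∘ₗ LinearMap.snd ℝ W W)
    have heq : ∀ p : W × W, (fun k : Fin 2 => (![fun p : W × W => K.mkQ (β p.1 p.2),
          fun p : W × W => K.mkQ (β ξ p.2)] k) p) =
          ![K.mkQ (β p.1 p.2), K.mkQ (β ξ p.2)] := by
      intro p; funext k; fin_cases k <;> rfl
    simp only [heq] at hLO
    obtain ⟨φ, hφ, hφZ⟩ := Submodule.exists_le_ker_of_notMem hne
    obtain ⟨p, h1, h2⟩ := LO.exists_and hLO (hb φ).ne_zero ⟨(ξ₀, η₀), ind_mk h0⟩ ⟨(ξ', η'), hφ⟩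
    exact h2 (hφZ (hC p.1 p.2 ξ p.2 (p.1 + ξ) p.2 (by simp) (hD _) h1))
  have hT := hspan Z hE
  intro x hx
  have h1 : Φ (⟨x, hx⟩, 0, 0) ∈ Z := by rw [hT]; trivial
  rw [hZ, hΘ, he, Submodule.mkQ_apply, Submodule.Quotient.mk_eq_zero] at h1
  exact h1

lemma EL [FiniteDimensional ℝ N] [Finite V] [DecidableEq V] (β : W →ₗ[ℝ] W →ₗ[ℝ] N)
    (hspan : ∀ S : Submodule ℝ N, (∀ ξ η, β ξ η ∈ S) → S = ⊤)
    (hN : 4 ≤ finrank ℝ N)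
    (Nv : Finset V)
    (C : Submodule ℝ (V → N)) (r : V → N) (ξ η : V → W)
    (hr : ∀ w, r w = β (ξ w) (η w) ∨ r w = 0)
    (G : W × W → Prop) (hGO : LO G) (hGne : ∃ x, G x)
    (hG : ∀ p, G p → ∃ x ∈ C, x ≠ 0 ∧ ∃ (a : N) (s μ : V → ℝ), ∀ w ∈ Nv,
      x w + s w • r w = a + μ w • β p.1 p.2)
    (hnc : ∀ x ∈ C, ∀ (a : N) (s : V → ℝ), (∀ w ∈ Nv, x w + s w • r w = a) → x = 0)
    (hCd : finrank ℝ C + 2 ≤ finrank ℝ N)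
    (h3 : finrank ℝ C + 2 = finrank ℝ N → ∀ i j, r i ≠ 0 → r j ≠ 0 → ∃ l ∈ Nv, l ≠ i ∧ l ≠ j)
    (g2 : ∀ i j l, i ≠ j → i ≠ l → j ≠ l →
      ∃ η', LinearIndependent ℝ ![β (ξ j) η', β (ξ j) (η j), β (ξ i) (η i), β (ξ l) (η l)])
    (g3 : ∀ i j l, i ≠ j → i ≠ l → j ≠ l →
      ∃ ξ' η', LinearIndependent ℝ ![β ξ' η', β (ξ j) η', β (ξ i) (η i), β (ξ l) (η l)]) :
    False := by
  let Φ : V → V → ((C × ℝ × ℝ) →ₗ[ℝ] N) := fun i j =>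
    LinearMap.coprod (((LinearMap.proj i : (V → N) →ₗ[ℝ] N) - LinearMap.proj j) ∘ₗ C.subtype)
      (LinearMap.coprod (LinearMap.toSpanSingleton ℝ N (r i))
        (- LinearMap.toSpanSingleton ℝ N (r j)))
  have hΦ : ∀ i j x s t, Φ i j (x, s, t) = x.1 i - x.1 j + s • r i - t • r j := by
    intro i j x s t
    simp [Φ, sub_eq_add_neg, add_assoc]
  have key : ∃ i ∈ Nv, ∃ j ∈ Nv, i ≠ j ∧ LinearMap.range (Φ i j) = ⊤ := by
    by_contra hne
    push Not at hne
    have h1 : ∀ q : V × V, q.1 ∈ Nv → q.2 ∈ Nv → q.1 ≠ q.2 → ∃ φ : Dual ℝ N, φ ≠ 0 ∧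
        LinearMap.range (Φ q.1 q.2) ≤ LinearMap.ker φ := by
      intro q ha hb hab
      exact Submodule.exists_le_ker_of_lt_top _ (lt_top_iff_ne_top.2 (hne _ ha _ hb hab))
    have hb : LPv (fun p : W × W => β p.1 p.2) := by
      simpa using LPv.bilin β (LinearMap.fst ℝ W W) (LinearMap.snd ℝ W W) 0 0
    choose! φ hφ0 hφ using h1
    let S : Set (V × V) := {q | q.1 ∈ Nv ∧ q.2 ∈ Nv ∧ q.1 ≠ q.2}
    have hS : S.Finite := Set.toFinite _
    obtain ⟨p, hp⟩ := LO.exists_all S hS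
      (G := fun q (p : W × W) => (φ q) (β p.1 p.2) ≠ 0) (fun q _ => (hb (φ q)).ne_zero) (by
        intro q hq
        by_contra hcon
        push Not at hcon
        have := hspan (LinearMap.ker (φ q)) (fun a b => hcon (a, b))
        exact hφ0 q hq.1 hq.2.1 hq.2.2 (LinearMap.ker_eq_top.1 this))
    obtain ⟨p, hpG, hp⟩ := LO.exists_and hGO (LO.all S hS
      (G := fun q (p : W × W) => (φ q) (β p.1 p.2) ≠ 0) (fun q _ => (hb (φ q)).ne_zero)) hGne ⟨p, hp⟩
    obtain ⟨x, hx, hx0, a, s, μ, h⟩ := hG p hpG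
    by_cases hμ : ∃ i ∈ Nv, ∃ j ∈ Nv, μ i ≠ μ j
    · obtain ⟨i, hi, j, hj, hij⟩ := hμ
      have hne : i ≠ j := fun h => hij (by rw [h])
      have e1 : Φ i j (⟨x, hx⟩, s i, s j) = (μ i - μ j) • β p.1 p.2 := by
        rw [hΦ]
        have : x i - x j + s i • r i - s j • r j = (x i + s i • r i) - (x j + s j • r j) := by abel
        simp only [this, h i hi, h j hj]
        module
      have e2 := hφ (i, j) hi hj hne ⟨_, e1⟩
      rw [LinearMap.mem_ker, map_smul, smul_eq_mul, mul_eq_zero] at e2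
      rcases e2 with e2 | e2
      · exact hij (by linarith)
      · exact hp (i, j) ⟨hi, hj, hne⟩ e2
    · push Not at hμ
      rcases Nv.eq_empty_or_nonempty with rfl | ⟨i0, hi0⟩
      · exact hx0 (hnc x hx 0 0 (by simp))
      · refine hx0 (hnc x hx (a + μ i0 • β p.1 p.2) s fun w hw => ?_)
        rw [h w hw, hμ w hw i0 hi0]
  obtain ⟨i, hi, j, hj, hij, hsur⟩ := key
  have hdim : finrank ℝ (C × ℝ × ℝ) = finrank ℝ C + 2 := by
    rw [finrank_prod, finrank_prod]; simp
  have hle : finrank ℝ N ≤ finrank ℝ (C × ℝ × ℝ) := by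
    have := LinearMap.finrank_range_le (Φ i j)
    rwa [hsur, finrank_top] at this
  have hdeq : finrank ℝ C + 2 = finrank ℝ N := by omega
  have hinjΦ : Function.Injective (Φ i j) :=
    (LinearMap.injective_iff_surjective_of_finrank_eq_finrank (by omega)).2
      (LinearMap.range_eq_top.1 hsur)
  have hinj : ∀ x ∈ C, ∀ s t : ℝ, x i - x j + s • r i - t • r j = 0 → x = 0 ∧ s = 0 ∧ t = 0 := by
    intro x hx s t h
    have : Φ i j (⟨x, hx⟩, s, t) = Φ i j 0 := by rw [hΦ, map_zero]; exact h
    have := hinjΦ this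
    simpa [Prod.ext_iff] using this
  have hsurj : ∀ n, ∃ x ∈ C, ∃ s t : ℝ, x i - x j + s • r i - t • r j = n := by
    intro n
    obtain ⟨⟨x, s, t⟩, h⟩ := LinearMap.range_eq_top.1 hsur n
    rw [hΦ] at h
    exact ⟨x.1, x.2, s, t, h⟩
  have hri : r i ≠ 0 := by
    intro h
    have := hinj 0 C.zero_mem 1 0 (by simp [h])
    simp at this
  have hrj : r j ≠ 0 := by
    intro h
    have := hinj 0 C.zero_mem 0 1 (by simp [h])
    simp at this
  obtain ⟨l, hl, hli, hlj⟩ := h3 hdeq i j hri hrj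
  have A := EL_step β hspan C r (fun w => β (ξ w) (η w)) hr G hGO hGne i j l
    (by
      intro p hp
      obtain ⟨x, hx, hx0, a, s, μ, h⟩ := hG p hp
      exact ⟨x, hx, hx0, a, s, μ, fun w hw => h w (by rcases hw with rfl | rfl | rfl <;> assumption)⟩)
    hinj hsurj (ξ j) (η j) rfl (g2 i j l hij hli.symm hlj.symm) (g3 i j l hij hli.symm hlj.symm)
  have B := EL_step β hspan C r (fun w => β (ξ w) (η w)) hr G hGO hGne j i l
    (by
      intro p hp
      obtain ⟨x, hx, hx0, a, s, μ, h⟩ := hG p hp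
      exact ⟨x, hx, hx0, a, s, μ, fun w hw => h w (by rcases hw with rfl | rfl | rfl <;> assumption)⟩)
    (by
      intro x hx s t h
      have := hinj x hx t s (by
        have e : x i - x j + t • r i - s • r j = -(x j - x i + s • r j - t • r i) := by abel
        rw [e, h, neg_zero])
      tauto)
    (by
      intro n
      obtain ⟨x, hx, s, t, h⟩ := hsurj (-n)
      refine ⟨x, hx, t, s, ?_⟩
      have e : x j - x i + t • r j - s • r i = -(x i - x j + s • r i - t • r j) := by abel
      rw [e, h, neg_neg])
    (ξ i) (η i) rfl (g2 j i l hij.symm hlj.symm hli.symm) (g3 j i l hij.symm hlj.symm hli.symm)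
  classical
  let T : Finset N := {β (ξ i) (η i), β (ξ j) (η j), β (ξ l) (η l)}
  have hT : T.card ≤ 3 := Finset.card_le_three
  have hsubT : ∀ w, (w = i ∨ w = j ∨ w = l) → r w ∈ Submodule.span ℝ (T : Set N) := by
    intro w hw
    rcases hr w with h | h
    · rw [h]
      apply Submodule.subset_span
      rcases hw with rfl | rfl | rfl <;> simp [T]
    · rw [h]; exact Submodule.zero_mem _
  have htop : Submodule.span ℝ (T : Set N) = ⊤ := by
    rw [eq_top_iff]
    intro n _
    obtain ⟨x, hx, s, t, h⟩ := hsurj n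
    have a1 : x l - x i ∈ Submodule.span ℝ (T : Set N) :=
      Submodule.span_mono (by intro y hy; simp at hy; rcases hy with rfl | rfl <;> simp [T]) (A x hx)
    have a2 : x l - x j ∈ Submodule.span ℝ (T : Set N) :=
      Submodule.span_mono (by intro y hy; simp at hy; rcases hy with rfl | rfl <;> simp [T]) (B x hx)
    have : n = (x l - x j) - (x l - x i) + s • r i - t • r j := by rw [← h]; abel
    rw [this]
    exact Submodule.sub_mem _ (Submodule.add_mem _ (Submodule.sub_mem _ a2 a1)
      (Submodule.smul_mem _ _ (hsubT _ (by simp)))) (Submodule.smul_mem _ _ (hsubT _ (by simp)))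
  have := finrank_span_finset_le_card (R := ℝ) T
  unfold Set.finrank at this
  rw [htop, finrank_top] at this
  omega

end EL
end BRB

namespace BRB
open Module

/-! ### Generic position -/

section Gen
set_option linter.unusedSectionVars false
variable {d : ℕ} {V E : Type} [DecidableEq V] [DecidableEq E]

lemma LO_four {X : Type*} [AddCommGroup X] [Module ℝ X] {N : Type*} [AddCommGroup N] [Module ℝ N]
    {w0 w1 w2 w3 : X → N} (h0 : LPv w0) (h1 : LPv w1) (h2 : LPv w2) (h3 : LPv w3) :
    LO (fun x => LinearIndependent ℝ ![w0 x, w1 x, w2 x, w3 x]) := by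
  have hLO : LO (fun x => LinearIndependent ℝ (fun k : Fin 4 => (![w0, w1, w2, w3] k) x)) := by
    apply LPv.LI
    intro k
    fin_cases k <;> assumption
  have heq : ∀ x, (fun k : Fin 4 => (![w0, w1, w2, w3] k) x) = ![w0 x, w1 x, w2 x, w3 x] := by
    intro p; funext k; fin_cases k <;> rfl
  simpa only [heq] using hLO

def bs (k : Fin (d + 1)) : Wd d := Pi.single k 1

lemma be_bs (p : Kp d) : be (bs p.1.1) (bs p.1.2) = dotProductEquiv ℝ (Kp d) (Pi.single p 1) := by
  rw [be_eq, bs, bs, wdg_basis]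

lemma be_LI {n : ℕ} (p : Fin n → Kp d) (hp : Function.Injective p) :
    LinearIndependent ℝ (fun k => be (bs (p k).1.1) (bs (p k).1.2)) := by
  simp only [be_bs]
  have h := (Pi.basisFun ℝ (Kp d)).linearIndependent.comp p hp
  have h2 := h.map' (dotProductEquiv ℝ (Kp d)).toLinearMap (LinearEquiv.ker _)
  have h3 : (fun k => dotProductEquiv ℝ (Kp d) (Pi.single (p k) 1)) =
      (dotProductEquiv ℝ (Kp d)).toLinearMap ∘ (Pi.basisFun ℝ (Kp d)) ∘ p := by
    funext k; simp [Pi.basisFun_apply]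
  rw [h3]
  exact h2

noncomputable def frL (v : V) (i : Fin 2) : Prm V E d →ₗ[ℝ] Wd d :=
  (LinearMap.proj i : (Fin 2 → Wd d) →ₗ[ℝ] Wd d) ∘ₗ
    (LinearMap.proj v : (V → Fin 2 → Wd d) →ₗ[ℝ] _) ∘ₗ LinearMap.fst ℝ _ (E → Fin 2 → Fin 3 → Wd d)

lemma frL_apply (v : V) (i : Fin 2) (P : Prm V E d) : frL v i P = P.1 v i := rfl

lemma LPv_fr (v : V) (i : Fin 2) : LPv (fun P : Prm V E d => P.1 v i) :=
  fun φ => LP.lin (φ ∘ₗ frL v i)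

lemma LPv_rho (v : V) : LPv (fun P : Prm V E d => be (P.1 v 0) (P.1 v 1)) := by
  simpa [frL_apply] using LPv.bilin be (frL (E := E) (d := d) v 0) (frL v 1) 0 0

lemma LPv_rhoc (v : V) (c : Wd d) : LPv (fun P : Prm V E d => be (P.1 v 0) c) := by
  simpa [frL_apply] using LPv.bilin be (frL (E := E) (d := d) v 0) (0 : Prm V E d →ₗ[ℝ] Wd d) 0 c

def g1 (P : Prm V E d) : Prop := ∀ q ∈ {q : V × V | q.1 ≠ q.2},
  LinearIndependent ℝ ![P.1 q.1 0, P.1 q.1 1, P.1 q.2 0, P.1 q.2 1]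

def g2 (k : Fin (d + 1)) (P : Prm V E d) : Prop :=
  ∀ q ∈ {q : V × V × V | q.1 ≠ q.2.1 ∧ q.1 ≠ q.2.2 ∧ q.2.1 ≠ q.2.2},
  LinearIndependent ℝ ![be (P.1 q.2.1 0) (bs k), be (P.1 q.2.1 0) (P.1 q.2.1 1),
    be (P.1 q.1 0) (P.1 q.1 1), be (P.1 q.2.2 0) (P.1 q.2.2 1)]

def g3 (k l : Fin (d + 1)) (P : Prm V E d) : Prop :=
  ∀ q ∈ {q : V × V × V | q.1 ≠ q.2.1 ∧ q.1 ≠ q.2.2 ∧ q.2.1 ≠ q.2.2},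
  LinearIndependent ℝ ![be (bs k) (bs l), be (P.1 q.2.1 0) (bs l),
    be (P.1 q.1 0) (P.1 q.1 1), be (P.1 q.2.2 0) (P.1 q.2.2 1)]

def gg (hd : 3 ≤ d) (P : Prm V E d) : Prop :=
  g1 P ∧ g2 ⟨1, by omega⟩ P ∧ g3 ⟨1, by omega⟩ ⟨3, by omega⟩ P

variable [Fintype V]

lemma gg_LO (hd : 3 ≤ d) : LO (gg (V := V) (E := E) hd) := by
  refine LO.and ?_ (LO.and ?_ ?_)
  · exact LO.all _ (Set.toFinite _) fun q _ => LO_four (LPv_fr _ _) (LPv_fr _ _) (LPv_fr _ _) (LPv_fr _ _)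
  · exact LO.all _ (Set.toFinite _) fun q _ =>
      LO_four (LPv_rhoc _ _) (LPv_rho _) (LPv_rho _) (LPv_rho _)
  · exact LO.all _ (Set.toFinite _) fun q _ =>
      LO_four (LPv.const _) (LPv_rhoc _ _) (LPv_rho _) (LPv_rho _)

lemma gg_ne (hd : 3 ≤ d) : ∃ P, gg (V := V) (E := E) hd P := by
  let e0 : Fin (d + 1) := ⟨0, by omega⟩
  let e1 : Fin (d + 1) := ⟨1, by omega⟩
  let e2 : Fin (d + 1) := ⟨2, by omega⟩
  let e3 : Fin (d + 1) := ⟨3, by omega⟩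
  have h1 : ∃ P, g1 (V := V) (E := E) (d := d) P := by
    refine LO.exists_all _ (Set.toFinite _)
      (fun q _ => LO_four (LPv_fr _ _) (LPv_fr _ _) (LPv_fr _ _) (LPv_fr _ _)) ?_
    rintro ⟨u, v⟩ huv
    replace huv : u ≠ v := huv
    refine ⟨(fun w => if w = u then ![bs e0, bs e1] else ![bs e2, bs e3], 0), ?_⟩
    simp only [if_true, huv.symm, if_false]
    have h := (Pi.basisFun ℝ (Fin (d+1))).linearIndependent.comp ![e0, e1, e2, e3] (by
      intro a b hab
      fin_cases a <;> fin_cases b <;> simp [e0, e1, e2, e3] at hab ⊢)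
    convert h using 1
    funext k; fin_cases k <;> simp [bs]
  have h2 : ∃ P, g2 (V := V) (E := E) (d := d) e1 P := by
    refine LO.exists_all _ (Set.toFinite _)
      (fun q _ => LO_four (LPv_rhoc _ _) (LPv_rho _) (LPv_rho _) (LPv_rho _)) ?_
    rintro ⟨i, j, l⟩ h
    obtain ⟨hij, hil, hjl⟩ : i ≠ j ∧ i ≠ l ∧ j ≠ l := h
    refine ⟨(fun w => if w = i then ![bs e0, bs e3] else if w = j then ![bs e0, bs e2] else
      ![bs e1, bs e2], 0), ?_⟩
    simp only [if_true, hij.symm, hil.symm, hjl.symm, if_false]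
    have h := be_LI (d := d) ![⟨(e0, e1), by show (_ : ℕ) < _; norm_num [e0, e1]⟩, ⟨(e0, e2), by show (_ : ℕ) < _; norm_num [e0, e2]⟩,
      ⟨(e0, e3), by show (_ : ℕ) < _; norm_num [e0, e3]⟩, ⟨(e1, e2), by show (_ : ℕ) < _; norm_num [e1, e2]⟩] (by
      intro a b hab
      fin_cases a <;> fin_cases b <;> simp [e0, e1, e2, e3] at hab ⊢)
    convert h using 1
    funext k; fin_cases k <;> simp
  have h3 : ∃ P, g3 (V := V) (E := E) (d := d) e1 e3 P := by
    refine LO.exists_all _ (Set.toFinite _)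
      (fun q _ => LO_four (LPv.const _) (LPv_rhoc _ _) (LPv_rho _) (LPv_rho _)) ?_
    rintro ⟨i, j, l⟩ h
    obtain ⟨hij, hil, hjl⟩ : i ≠ j ∧ i ≠ l ∧ j ≠ l := h
    refine ⟨(fun w => if w = i then ![bs e0, bs e1] else if w = j then ![bs e0, bs e2] else
      ![bs e1, bs e2], 0), ?_⟩
    simp only [if_true, hij.symm, hil.symm, hjl.symm, if_false]
    have h := be_LI (d := d) ![⟨(e1, e3), by show (_ : ℕ) < _; norm_num [e1, e3]⟩, ⟨(e0, e3), by show (_ : ℕ) < _; norm_num [e0, e3]⟩,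
      ⟨(e0, e1), by show (_ : ℕ) < _; norm_num [e0, e1]⟩, ⟨(e1, e2), by show (_ : ℕ) < _; norm_num [e1, e2]⟩] (by
      intro a b hab
      fin_cases a <;> fin_cases b <;> simp [e0, e1, e2, e3] at hab ⊢)
    convert h using 1
    funext k; fin_cases k <;> simp
  have L1 : LO (g1 (V := V) (E := E) (d := d)) :=
    LO.all _ (Set.toFinite _) fun q _ => LO_four (LPv_fr _ _) (LPv_fr _ _) (LPv_fr _ _) (LPv_fr _ _)
  have L2 : LO (g2 (V := V) (E := E) (d := d) e1) :=
    LO.all _ (Set.toFinite _) fun q _ =>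
      LO_four (LPv_rhoc _ _) (LPv_rho _) (LPv_rho _) (LPv_rho _)
  have L3 : LO (g3 (V := V) (E := E) (d := d) e1 e3) :=
    LO.all _ (Set.toFinite _) fun q _ =>
      LO_four (LPv.const _) (LPv_rhoc _ _) (LPv_rho _) (LPv_rho _)
  exact LO.exists_and L1 (L2.and L3) h1 (LO.exists_and L2 L3 h2 h3)

lemma gg_triple (hd : 3 ≤ d) {P : Prm V E d} (h : gg hd P) {i j l : V} (hij : i ≠ j) (hil : i ≠ l)
    (hjl : j ≠ l) {a b c : ℝ} (h0 : a • be (P.1 j 0) (P.1 j 1) + b • be (P.1 i 0) (P.1 i 1) +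
      c • be (P.1 l 0) (P.1 l 1) = 0) : a = 0 ∧ b = 0 ∧ c = 0 := by
  have := h.2.1 (i, j, l) ⟨hij, hil, hjl⟩
  rw [Fintype.linearIndependent_iff] at this
  have h2 := this ![0, a, b, c] (by simpa [Fin.sum_univ_four, add_assoc] using h0)
  exact ⟨by simpa using h2 1, by simpa using h2 2, by simpa using h2 3⟩

/-! ### Annihilators -/

variable (R : Finset V) (ends : E → V × V)

noncomputable def lsm : (V → Nn d) ≃ₗ[ℝ] Dual ℝ (V → Mm d) :=
  LinearMap.lsum ℝ (fun _ : V => Mm d) ℝ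

lemma lsm_sgn (y : V → Nn d) (u v : V) (q : Mm d) : lsm y (sgn u v q) = y u q - y v q := by
  have h : ∀ w : V, lsm y (Pi.single w q) = y w q := by
    intro w
    rw [lsm, LinearMap.lsum_apply, LinearMap.sum_apply]
    rw [Finset.sum_eq_single w]
    · simp
    · intro b _ hb
      simp [Pi.single_eq_of_ne hb]
    · simp
  have h2 : sgn u v q = Pi.single u q - Pi.single v q := rfl
  rw [h2, map_sub, h, h]

noncomputable def annE (P : Prm V E d) (F : Finset E) : Submodule ℝ (V → Nn d) :=
  (Submodule.span ℝ (vec R ends P '' F)).dualAnnihilator.comap (lsm (d := d) (V := V)).toLinearMap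

lemma mem_annE {P : Prm V E d} {F : Finset E} {y : V → Nn d} :
    y ∈ annE R ends P F ↔ ∀ e ∈ F, y (ends e).1 (qV R ends P e) = y (ends e).2 (qV R ends P e) := by
  rw [annE, Submodule.mem_comap, Submodule.mem_dualAnnihilator]
  constructor
  · intro h e he
    have := h (vec R ends P e) (Submodule.subset_span ⟨e, he, rfl⟩)
    rw [vec] at this
    rw [← sub_eq_zero, ← this]
    exact (lsm_sgn _ _ _ _).symm
  · intro h w hw
    have : Submodule.span ℝ (vec R ends P '' F) ≤ LinearMap.ker (lsm y) := by
      rw [Submodule.span_le]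
      rintro _ ⟨e, he, rfl⟩
      rw [SetLike.mem_coe, LinearMap.mem_ker, vec, lsm_sgn, h e he, sub_self]
    exact this hw

lemma finrank_VN : finrank ℝ (V → Nn d) = (d + 1).choose 2 * Fintype.card V := by
  rw [finrank_pi_fintype]
  simp [finrank_Nn, mul_comm, -Subspace.dual_finrank_eq]

lemma finrank_annE {P : Prm V E d} {F : Finset E} (h : Good R ends F P) :
    finrank ℝ (annE R ends P F) + F.card = (d + 1).choose 2 * Fintype.card V := by
  have h1 : finrank ℝ (annE R ends P F) =
      finrank ℝ (Submodule.span ℝ (vec R ends P '' F)).dualAnnihilator := by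
    rw [annE]
    have : (Submodule.span ℝ (vec R ends P '' F)).dualAnnihilator.comap
      (lsm (d := d) (V := V)).toLinearMap =
      (Submodule.span ℝ (vec R ends P '' F)).dualAnnihilator.map
      (lsm (d := d) (V := V)).symm.toLinearMap := by
      ext x; simp [Submodule.mem_map_equiv]
    rw [this]
    exact LinearEquiv.finrank_map_eq _ _
  have h2 : finrank ℝ (Submodule.span ℝ (vec R ends P '' F)) = F.card := by
    have h3 := finrank_span_eq_card h
    have h4 : Set.range (fun e : {x // x ∈ F} => vec R ends P e.1) = vec R ends P '' F := by
      ext x; simp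
    rw [h4] at h3
    simpa using h3
  have h5 := Subspace.finrank_add_finrank_dualAnnihilator_eq
    (Submodule.span ℝ (vec R ends P '' F))
  have h6 : finrank ℝ (V → Mm d) = (d + 1).choose 2 * Fintype.card V := by
    rw [← finrank_VN (d := d) (V := V), ← (lsm (d := d) (V := V)).symm.finrank_eq,
      Subspace.dual_finrank_eq]
  omega

lemma span_of_bad {P : Prm V E d} {I : Finset E} {e : E} (he : e ∈ I) (hb : ¬ Good R ends I P)
    (hg : Good R ends (I.erase e) P) :
    vec R ends P e ∈ Submodule.span ℝ (vec R ends P '' (I.erase e : Finset E)) := by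
  by_contra hn
  apply hb
  have h1 : LinearIndepOn ℝ (vec R ends P) ((I.erase e : Finset E) : Set E) := hg
  have h2 := (linearIndepOn_insert (a := e) (s := ((I.erase e : Finset E) : Set E))
    (by simp)).2 ⟨h1, hn⟩
  rw [← Finset.coe_insert, Finset.insert_erase he] at h2
  exact h2

end Gen
end BRB

namespace BRB
open Module

/-! ### The main induction -/

section Main
set_option linter.unusedSectionVars false
variable {d : ℕ} {V E : Type} [DecidableEq V] [DecidableEq E] [Fintype V]
variable {R : Finset V} {ends : E → V × V}

lemma qV_congr {P P' : Prm V E d} {e : E} (h1 : P.1 (ends e).1 = P'.1 (ends e).1)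
    (h2 : P.1 (ends e).2 = P'.1 (ends e).2) (h3 : P.2 e = P'.2 e) :
    qV R ends P e = qV R ends P' e := by
  simp only [qV, aV, bV, h1, h2, h3]

lemma Good.mono {P : Prm V E d} {I J : Finset E} (h : Good R ends I P) (hJ : J ⊆ I) :
    Good R ends J P := by
  have h1 : LinearIndepOn ℝ (vec R ends P) (I : Set E) := h
  exact h1.mono (by exact_mod_cast hJ)

lemma annE_anti {P : Prm V E d} {I J : Finset E} (hJ : J ⊆ I) :
    annE R ends P I ≤ annE R ends P J := by
  intro y hy
  rw [mem_annE] at hy ⊢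
  exact fun e he => hy e (hJ he)

lemma annE_erase {P : Prm V E d} {I : Finset E} {e : E} (he : e ∈ I) (hb : ¬ Good R ends I P)
    (hg : Good R ends (I.erase e) P) : annE R ends P I = annE R ends P (I.erase e) := by
  apply le_antisymm (annE_anti (Finset.erase_subset _ _))
  intro y hy
  have h1 := span_of_bad R ends he hb hg
  have h2 : lsm y (vec R ends P e) = 0 := by
    rw [annE, Submodule.mem_comap, Submodule.mem_dualAnnihilator] at hy
    exact hy _ h1
  rw [vec, lsm_sgn, sub_eq_zero] at h2
  rw [mem_annE] at hy ⊢
  intro e' he'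
  by_cases hee : e' = e
  · rw [hee]; exact h2
  · exact hy e' (Finset.mem_erase.2 ⟨hee, he'⟩)

lemma subA (hd : 3 ≤ d) {P : Prm V E d} (hgg : gg hd P) {I : Finset E}
    (hbad : ∀ P : Prm V E d, ¬ Good R ends I P) {e : E} (he : e ∈ I)
    (hne : (ends e).1 ≠ (ends e).2) (hg : Good R ends (I.erase e) P) {y : V → Nn d}
    (hy : y ∈ annE R ends P (I.erase e)) :
    ∃ s t : ℝ, y (ends e).1 - y (ends e).2 = s • rV R P (ends e).1 + t • rV R P (ends e).2 := by
  have h4 : LinearIndependent ℝ ![P.1 (ends e).1 0, P.1 (ends e).1 1, P.1 (ends e).2 0,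
    P.1 (ends e).2 1] := hgg.1 ((ends e).1, (ends e).2) hne
  have hf1 : LinearIndependent ℝ (P.1 (ends e).1) := by
    have := h4.comp ![0, 1] (by decide)
    convert this using 1
    funext k; fin_cases k <;> rfl
  have hf2 : LinearIndependent ℝ (P.1 (ends e).2) := by
    have := h4.comp ![2, 3] (by decide)
    convert this using 1
    funext k; fin_cases k <;> rfl
  apply span_lemma h4
  intro a c ha hc
  obtain ⟨z, hz⟩ := pt_surj _ hf1 ha
  obtain ⟨z', hz'⟩ := pt_surj _ hf2 hc
  let P' : Prm V E d := (P.1, Function.update P.2 e ![z, z'])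
  have hq : ∀ e' ∈ I.erase e, qV R ends P' e' = qV R ends P e' := by
    intro e' he'
    refine qV_congr rfl rfl ?_
    simp [P', Function.update_of_ne (Finset.ne_of_mem_erase he')]
  have hqe : qV R ends P' e = wdg a c := by
    simp only [qV, aV, bV, P', Function.update_self]
    simp [hz, hz']
  have hg' : Good R ends (I.erase e) P' := by
    unfold Good at hg ⊢
    convert hg using 2 with x
    simp only [vec, hq _ x.2]
  have hy' : y ∈ annE R ends P' (I.erase e) := by
    rw [mem_annE] at hy ⊢
    intro e' he'
    rw [hq e' he']; exact hy e' he'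
  rw [← annE_erase he (hbad P') hg', mem_annE] at hy'
  have := hy' e he
  rw [hqe] at this
  rw [LinearMap.sub_apply, this, sub_self]

lemma rV_eq (P : Prm V E d) (w : V) :
    rV R P w = (if w ∈ R then (1:ℝ) else 0) • be (P.1 w 0) (P.1 w 1) := by
  unfold rV rr
  split_ifs <;> simp

lemma finrank_span_rV_le (P : Prm V E d) (v w : V) :
    finrank ℝ (Submodule.span ℝ {(Pi.single v (rV R P w) : V → Nn d)}) ≤
      (if w ∈ R then 1 else 0) := by
  split_ifs with h
  · exact (finrank_span_le_card _).trans (by simp)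
  · rw [rV_eq]; simp [h]

lemma core_dim (hd : 3 ≤ d) {I : Finset E} (hl : ∀ e ∈ I, (ends e).1 ≠ (ends e).2)
    (hI : Sp ((d + 1).choose 2) R ends I) {v : V} (hv : v ∈ VF ends I) {P : Prm V E d}
    (hgg : gg hd P) (hbad : ∀ P : Prm V E d, ¬ Good R ends I P)
    (hgood : ∀ e ∈ inc ends I v, Good R ends (I.erase e) P) (C : Submodule ℝ (V → Nn d))
    (hC : C ≤ annE R ends P (I \ inc ends I v))
    (hk : (inc ends I v).card + (if v ∈ R then 1 else 0) ≤ (d + 1).choose 2 + finrank ℝ C) :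
    ∃ x ∈ C, x ≠ 0 ∧ ∃ (a : Nn d) (s μ : V → ℝ), ∀ w ∈ nbr ends I v,
      x w + s w • rV R P w = a + μ w • rV R P v := by
  have hA : ∀ y ∈ annE R ends P I, ∀ w ∈ nbr ends I v, ∃ s t : ℝ,
      y w - y v = s • rV R P w + t • rV R P v := by
    intro y hy w hw
    obtain ⟨hwv, e, he, h1, h2⟩ := mem_nbr.1 hw
    have hei : e ∈ inc ends I v := Finset.mem_filter.2 ⟨he, h1⟩
    obtain ⟨s, t, hst⟩ := subA hd hgg hbad he (hl e he) (hgood e hei)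
      (annE_anti (Finset.erase_subset _ _) hy)
    rcases h1 with h1 | h1
    · have h2 : (ends e).2 = w := by
        rcases h2 with h2 | h2
        · exact absurd (h2.symm.trans h1) hwv
        · exact h2
      rw [h1, h2] at hst
      refine ⟨-t, -s, ?_⟩
      rw [← neg_sub, hst]; module
    · have h2 : (ends e).1 = w := by
        rcases h2 with h2 | h2
        · exact h2
        · exact absurd (h2.symm.trans h1) hwv
      rw [h1, h2] at hst
      exact ⟨s, t, hst⟩
  obtain ⟨e0, he0, hev⟩ := mem_VF.1 hv
  have hei0 : e0 ∈ inc ends I v := Finset.mem_filter.2 ⟨he0, hev⟩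
  have hincI : inc ends I v ⊆ I := Finset.filter_subset _ _
  set J := I \ inc ends I v with hJ
  have hJg : Good R ends J P := (hgood e0 hei0).mono (by
    intro e he
    rw [hJ, Finset.mem_sdiff] at he
    refine Finset.mem_erase.2 ⟨?_, he.1⟩
    rintro rfl
    exact he.2 hei0)
  have hdJ := finrank_annE R ends hJg
  have hdI := finrank_annE R ends (hgood e0 hei0)
  rw [← annE_erase he0 (hbad P) (hgood e0 hei0), Finset.card_erase_of_mem he0] at hdI
  have hcI : 1 ≤ I.card := Finset.card_pos.2 ⟨e0, he0⟩
  have hcJ : J.card + (inc ends I v).card = I.card := Finset.card_sdiff_add_card_eq_card hincI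
  let Sv : Submodule ℝ (V → Nn d) := LinearMap.range (LinearMap.single ℝ (fun _ : V => Nn d) v)
  have hSv : finrank ℝ Sv = (d + 1).choose 2 := by
    rw [LinearMap.finrank_range_of_inj, finrank_Nn]
    exact Pi.single_injective (M := fun _ : V => Nn d) v
  have hSvJ : Sv ≤ annE R ends P J := by
    rintro _ ⟨n, rfl⟩
    rw [mem_annE]
    intro e he
    rw [hJ, Finset.mem_sdiff, inc, Finset.mem_filter] at he
    have h1 : (ends e).1 ≠ v := fun h => he.2 ⟨he.1, Or.inl h⟩
    have h2 : (ends e).2 ≠ v := fun h => he.2 ⟨he.1, Or.inr h⟩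
    simp [Pi.single_eq_of_ne h1, Pi.single_eq_of_ne h2]
  have hYJ : annE R ends P I ⊔ Sv ≤ annE R ends P J :=
    sup_le (annE_anti Finset.sdiff_subset) hSvJ
  have hsingle : ∀ n : Nn d, (Pi.single v n : V → Nn d) ∈ annE R ends P I → ∀ w ∈ nbr ends I v,
      ∃ s t : ℝ, n = s • rV R P w + t • rV R P v := by
    intro n hn w hw
    obtain ⟨s, t, hst⟩ := hA _ hn w hw
    rw [Pi.single_eq_of_ne (mem_nbr.1 hw).1, Pi.single_eq_same] at hst
    refine ⟨-s, -t, ?_⟩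
    have : n = - (0 - n) := by simp
    rw [this, hst]; module
  have hdim : (inc ends I v).card + finrank ℝ ((annE R ends P I ⊓ Sv : Submodule ℝ (V → Nn d))) ≤
      (d + 1).choose 2 + finrank ℝ C := by
    by_cases hN : ∃ w, v ≠ w ∧ nbr ends I v ⊆ {w}
    · obtain ⟨w, hvw, hN⟩ := hN
      have hdeg := deg_le_of_nbr hl hI hvw hN
      have hwn : w ∈ nbr ends I v := by
        have : ∃ w', w' ∈ nbr ends I v := by
          rcases hev with h | h
          · exact ⟨(ends e0).2, mem_nbr.2 ⟨by rw [← h]; exact (hl e0 he0).symm, e0, he0, Or.inl h,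
              Or.inr rfl⟩⟩
          · exact ⟨(ends e0).1, mem_nbr.2 ⟨by rw [← h]; exact (hl e0 he0), e0, he0, Or.inr h,
              Or.inl rfl⟩⟩
        obtain ⟨w', hw'⟩ := this
        have := Finset.mem_singleton.1 (hN hw')
        rwa [← this]
      have hle : (annE R ends P I ⊓ Sv : Submodule ℝ (V → Nn d)) ≤
          Submodule.span ℝ {(Pi.single v (rV R P w) : V → Nn d)} ⊔
          Submodule.span ℝ {(Pi.single v (rV R P v) : V → Nn d)} := by
        rintro _ ⟨hy, n, rfl⟩
        obtain ⟨s, t, hst⟩ := hsingle n hy w hwn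
        rw [LinearMap.single_apply, hst, Pi.single_add, Pi.single_smul, Pi.single_smul]
        exact Submodule.add_mem_sup (Submodule.smul_mem _ _ (Submodule.mem_span_singleton_self _))
          (Submodule.smul_mem _ _ (Submodule.mem_span_singleton_self _))
      have h1 := Submodule.finrank_mono hle
      have h2 := Submodule.finrank_add_le_finrank_add_finrank
        (Submodule.span ℝ {(Pi.single v (rV R P w) : V → Nn d)})
        (Submodule.span ℝ {(Pi.single v (rV R P v) : V → Nn d)})
      have h3 := finrank_span_rV_le (R := R) P v w
      have h4 := finrank_span_rV_le (R := R) P v v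
      zify at h1 h2 h3 h4 ⊢
      linarith
    · push Not at hN
      have hle : (annE R ends P I ⊓ Sv : Submodule ℝ (V → Nn d)) ≤
          Submodule.span ℝ {(Pi.single v (rV R P v) : V → Nn d)} := by
        rintro _ ⟨hy, n, rfl⟩
        have hw1 : ∃ w1, w1 ∈ nbr ends I v := by
          rcases hev with h | h
          · exact ⟨(ends e0).2, mem_nbr.2 ⟨by rw [← h]; exact (hl e0 he0).symm, e0, he0, Or.inl h,
              Or.inr rfl⟩⟩
          · exact ⟨(ends e0).1, mem_nbr.2 ⟨by rw [← h]; exact (hl e0 he0), e0, he0, Or.inr h,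
              Or.inl rfl⟩⟩
        obtain ⟨w1, hw1⟩ := hw1
        have hv1 := (mem_nbr.1 hw1).1
        obtain ⟨w2, hw2, hw12⟩ := Finset.not_subset.1 (hN w1 hv1.symm)
        rw [Finset.mem_singleton] at hw12
        have hv2 := (mem_nbr.1 hw2).1
        obtain ⟨s, t, hst⟩ := hsingle n hy w1 hw1
        obtain ⟨s', t', hst'⟩ := hsingle n hy w2 hw2
        have h0 := hst.symm.trans hst'
        have hs0 : s * (if w1 ∈ R then (1:ℝ) else 0) = 0 := by
          refine (gg_triple hd hgg (i := w1) (j := v) (l := w2) hv1 (Ne.symm hw12) hv2.symm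
            (a := (t - t') * (if v ∈ R then (1:ℝ) else 0)) (b := s * (if w1 ∈ R then (1:ℝ) else 0))
            (c := - s' * (if w2 ∈ R then (1:ℝ) else 0)) ?_).2.1
          rw [mul_smul, mul_smul, mul_smul, ← rV_eq, ← rV_eq, ← rV_eq]
          rw [← sub_eq_zero] at h0
          rw [← h0]; module
        have hn : n = t • rV R P v := by
          rw [hst, rV_eq (R := R) P w1, ← mul_smul, hs0]; simp
        rw [LinearMap.single_apply, hn, Pi.single_smul]
        exact Submodule.smul_mem _ _ (Submodule.mem_span_singleton_self _)
      have h1 := Submodule.finrank_mono hle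
      have h4 := finrank_span_rV_le (R := R) P v v
      omega
  have hs1 := Submodule.finrank_sup_add_finrank_inf_eq (annE R ends P I) Sv
  have hs2 := Submodule.finrank_sup_add_finrank_inf_eq (annE R ends P I ⊔ Sv) C
  have hs3 := Submodule.finrank_mono (sup_le hYJ hC)
  have hpos : 0 < finrank ℝ (((annE R ends P I ⊔ Sv) ⊓ C : Submodule ℝ (V → Nn d))) := by
    omega
  have hbot : ((annE R ends P I ⊔ Sv) ⊓ C : Submodule ℝ (V → Nn d)) ≠ ⊥ := by
    intro h
    rw [h] at hpos
    simp at hpos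
  obtain ⟨x, hx, hx0⟩ := Submodule.exists_mem_ne_zero_of_ne_bot hbot
  refine ⟨x, hx.2, hx0, ?_⟩
  obtain ⟨y, hy, z, ⟨n, rfl⟩, rfl⟩ := Submodule.mem_sup.1 hx.1
  have hch : ∀ w, ∃ s t : ℝ, w ∈ nbr ends I v → y w - y v = s • rV R P w + t • rV R P v := by
    intro w
    by_cases hw : w ∈ nbr ends I v
    · obtain ⟨s, t, h⟩ := hA y hy w hw
      exact ⟨s, t, fun _ => h⟩
    · exact ⟨0, 0, fun h => absurd h hw⟩
  choose s t hst using hch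
  refine ⟨y v, fun w => - s w, t, ?_⟩
  intro w hw
  have h1 := hst w hw
  have h2 : (y + LinearMap.single ℝ (fun _ : V => Nn d) v n) w = y w := by
    simp [Pi.single_eq_of_ne (mem_nbr.1 hw).1]
  rw [h2, sub_eq_iff_eq_add.1 h1]
  module

def pr (P : Prm V E d) (v : V) (p : Wd d × Wd d) : Prm V E d :=
  (Function.update P.1 v ![p.1, p.2], P.2)

noncomputable def prL (v : V) : (Wd d × Wd d) →ₗ[ℝ] Prm V E d :=
  LinearMap.inl ℝ (V → Fin 2 → Wd d) (E → Fin 2 → Fin 3 → Wd d) ∘ₗ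
    LinearMap.single ℝ (fun _ : V => Fin 2 → Wd d) v ∘ₗ
      (LinearMap.pi ![LinearMap.fst ℝ (Wd d) (Wd d), LinearMap.snd ℝ (Wd d) (Wd d)])

lemma pr_eq (P : Prm V E d) (v : V) (p : Wd d × Wd d) :
    pr P v p = (Function.update P.1 v 0, P.2) + prL v p := by
  refine Prod.ext ?_ ?_
  · funext w i
    by_cases hw : w = v
    · subst hw
      fin_cases i <;> simp [pr, prL]
    · simp [pr, prL, hw]
  · simp [pr, prL]

lemma core (hd : 3 ≤ d) {I : Finset E} (hl : ∀ e ∈ I, (ends e).1 ≠ (ends e).2)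
    (hI : Sp ((d + 1).choose 2) R ends I) {v : V} (hv : v ∈ VF ends I)
    (hlow : (inc ends I v).card + 2 * (if v ∈ R then 1 else 0) + 1 ≤ 2 * (d + 1).choose 2)
    (K : Finset E)
    (hK : K.card = (inc ends I v).card + (if v ∈ R then 1 else 0) - (d + 1).choose 2)
    (hKI : Disjoint K I)
    (hKn : ∀ e ∈ K, (ends e).1 ∈ nbr ends I v ∧ (ends e).2 ∈ nbr ends I v ∧ (ends e).1 ≠ (ends e).2)
    (h1 : ∀ e ∈ inc ends I v, ∃ P : Prm V E d, Good R ends (I.erase e) P)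
    (h2 : ∃ P : Prm V E d, Good R ends ((I \ inc ends I v) ∪ K) P) :
    ∃ P : Prm V E d, Good R ends I P := by
  by_contra hbad
  push Not at hbad
  have hD6 : 6 ≤ (d + 1).choose 2 := by
    have := Nat.choose_le_choose 2 (show 4 ≤ d + 1 by omega)
    simpa [Nat.choose] using this
  set J := I \ inc ends I v with hJ
  let Gen : Prm V E d → Prop := fun P => gg hd P ∧
    (∀ e ∈ (inc ends I v : Set E), Good R ends (I.erase e) P) ∧ Good R ends (J ∪ K) P
  have hLO2 : LO (fun P : Prm V E d => ∀ e ∈ (inc ends I v : Set E), Good R ends (I.erase e) P) :=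
    LO.all _ (Finset.finite_toSet _) fun e _ => Good_LO R ends _
  have hGenO : LO Gen := (gg_LO hd).and (hLO2.and (Good_LO R ends _))
  obtain ⟨P0, hP0⟩ : ∃ P, Gen P :=
    LO.exists_and (gg_LO hd) (hLO2.and (Good_LO R ends _)) (gg_ne hd)
      (LO.exists_and hLO2 (Good_LO R ends _)
        (LO.exists_all _ (Finset.finite_toSet _) (fun e _ => Good_LO R ends _) h1) h2)
  obtain ⟨C0, hC0⟩ := Submodule.exists_isCompl (annE R ends P0 (J ∪ K))
  have hle : annE R ends P0 (J ∪ K) ≤ annE R ends P0 J := annE_anti Finset.subset_union_left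
  set C := C0 ⊓ annE R ends P0 J with hC
  have hCsup : annE R ends P0 (J ∪ K) ⊔ C = annE R ends P0 J := by
    rw [hC, ← sup_inf_assoc_of_le _ hle, hC0.sup_eq_top, top_inf_eq]
  have hCinf : annE R ends P0 (J ∪ K) ⊓ C = ⊥ := by
    rw [eq_bot_iff, ← hC0.inf_eq_bot]
    exact inf_le_inf_left _ inf_le_left
  have hJK : (J ∪ K).card = J.card + K.card := by
    apply Finset.card_union_of_disjoint
    exact (hKI.mono_right Finset.sdiff_subset).symm
  have hfC : finrank ℝ C = K.card := by
    have e1 := Submodule.finrank_sup_add_finrank_inf_eq (annE R ends P0 (J ∪ K)) C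
    rw [hCsup, hCinf, finrank_bot] at e1
    have e2 := finrank_annE R ends hP0.2.2
    have e3 := finrank_annE R ends (hP0.2.2.mono Finset.subset_union_left)
    omega
  have hnc : ∀ x ∈ C, ∀ (a : Nn d) (s : V → ℝ), (∀ w ∈ nbr ends I v, x w + s w • rV R P0 w = a) →
      x = 0 := by
    intro x hx a s hs
    have : x ∈ annE R ends P0 (J ∪ K) ⊓ C := by
      refine ⟨?_, hx⟩
      rw [SetLike.mem_coe, mem_annE]
      intro e he
      rcases Finset.mem_union.1 he with he | he
      · exact mem_annE R ends |>.1 hx.2 e he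
      · obtain ⟨n1, n2, -⟩ := hKn e he
        rw [eq_sub_of_add_eq (hs _ n1), eq_sub_of_add_eq (hs _ n2)]
        simp [rV_fst, rV_snd]
    rw [hCinf] at this
    exact this
  have hkk : (inc ends I v).card + (if v ∈ R then 1 else 0) ≤ (d + 1).choose 2 + finrank ℝ C := by
    omega
  by_cases hvR : v ∈ R
  · have hJv : ∀ e ∈ J, (ends e).1 ≠ v ∧ (ends e).2 ≠ v := by
      intro e he
      rw [hJ, Finset.mem_sdiff, inc, Finset.mem_filter] at he
      exact ⟨fun h => he.2 ⟨he.1, Or.inl h⟩, fun h => he.2 ⟨he.1, Or.inr h⟩⟩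
    refine EL (be (d := d)) be_span (by rw [finrank_Nn]; omega) (nbr ends I v) C (rV R P0)
      (fun w => P0.1 w 0) (fun w => P0.1 w 1) ?_ (fun p => Gen (pr P0 v p)) ?_ ?_ ?_ hnc ?_ ?_ ?_ ?_
    · intro w
      rw [rV_eq]
      split_ifs <;> simp
    · simp only [pr_eq]
      exact hGenO.comp _ _
    · refine ⟨(P0.1 v 0, P0.1 v 1), ?_⟩
      have : pr P0 v (P0.1 v 0, P0.1 v 1) = P0 := by
        refine Prod.ext ?_ rfl
        simp only [pr]
        rw [Function.update_eq_self_iff]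
        funext i; fin_cases i <;> rfl
      rw [this]; exact hP0
    · intro p hp
      have hCp : C ≤ annE R ends (pr P0 v p) J := by
        refine inf_le_right.trans ?_
        intro y hy
        rw [mem_annE] at hy ⊢
        intro e he
        have : qV R ends (pr P0 v p) e = qV R ends P0 e := by
          refine qV_congr ?_ ?_ rfl
          · simp [pr, (hJv e he).1]
          · simp [pr, (hJv e he).2]
        rw [this]; exact hy e he
      obtain ⟨x, hx, hx0, a, s, μ, h⟩ := core_dim hd hl hI hv hp.1 hbad hp.2.1 C hCp hkk
      refine ⟨x, hx, hx0, a, s, μ, ?_⟩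
      intro w hw
      have h3 := h w hw
      have e1 : rV R (pr P0 v p) w = rV R P0 w := by
        simp [rV, pr, (mem_nbr.1 hw).1]
      have e2 : rV R (pr P0 v p) v = be p.1 p.2 := by
        simp [rV, rr, pr, hvR]
      rw [e1, e2] at h3
      exact h3
    · rw [finrank_Nn, hfC]
      simp only [hvR, if_true] at hlow hK
      omega
    · intro hk i j hi hj
      rw [finrank_Nn, hfC] at hk
      have hmem : ∀ i, rV R P0 i ≠ 0 → i ∈ R := by
        intro i hi
        by_contra hn
        apply hi
        rw [rV_eq]; simp [hn]
      simp only [hvR, if_true] at hK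
      exact third_nbr hl hI hvR (hmem i hi) (hmem j hj) (by omega) (by omega)
    · intro i j l hij hil hjl
      exact ⟨_, hP0.1.2.1 (i, j, l) ⟨hij, hil, hjl⟩⟩
    · intro i j l hij hil hjl
      exact ⟨_, _, hP0.1.2.2 (i, j, l) ⟨hij, hil, hjl⟩⟩
  · obtain ⟨x, hx, hx0, a, s, μ, h⟩ := core_dim hd hl hI hv hP0.1 hbad hP0.2.1 C inf_le_right hkk
    apply hx0
    refine hnc x hx a s ?_
    intro w hw
    rw [h w hw, rV_eq P0 v]
    simp [hvR]

theorem T (hd : 3 ≤ d) (hfresh : ∀ (a b : V) (s : Finset E), ∃ e ∉ s, ends e = (a, b)) :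
    ∀ (m n : ℕ) (I : Finset E), (VF ends I).card ≤ m → I.card ≤ n →
      (∀ e ∈ I, (ends e).1 ≠ (ends e).2) → Sp ((d + 1).choose 2) R ends I →
      ∃ P : Prm V E d, Good R ends I P := by
  have hD6 : 6 ≤ (d + 1).choose 2 := by
    have := Nat.choose_le_choose 2 (show 4 ≤ d + 1 by omega)
    simpa [Nat.choose] using this
  have hempty : ∃ P : Prm V E d, Good R ends ∅ P := ⟨0, by
    unfold Good
    exact linearIndependent_empty_type⟩
  intro m
  induction m with
  | zero =>
    intro n I hm _ _ _
    have : I = ∅ := by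
      by_contra hne
      obtain ⟨e, he⟩ := Finset.nonempty_iff_ne_empty.2 hne
      have : (ends e).1 ∈ VF ends I := mem_VF.2 ⟨e, he, Or.inl rfl⟩
      have := Finset.card_pos.2 ⟨_, this⟩
      omega
    rw [this]; exact hempty
  | succ m ihm =>
    intro n
    induction n with
    | zero =>
      intro I _ hn _ _
      have : I = ∅ := Finset.card_eq_zero.1 (by omega)
      rw [this]; exact hempty
    | succ n ihn =>
      intro I hm hn hl hI
      rcases I.eq_empty_or_nonempty with h0 | hne
      · rw [h0]; exact hempty
      obtain ⟨v, hv, hlow⟩ := exists_low (by omega) hl hI hne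
      obtain ⟨K, hK, hKI, hKn, hKS⟩ := lemC (by omega) hfresh hl hI v
        ((inc ends I v).card + (if v ∈ R then 1 else 0) - (d + 1).choose 2) (by
          split_ifs <;> omega)
      refine core hd hl hI hv hlow K hK hKI hKn ?_ ?_
      · intro e he
        have heI : e ∈ I := Finset.filter_subset _ _ he
        refine ihn _ ?_ ?_ (fun e he => hl e (Finset.erase_subset _ _ he))
          (hI.mono (Finset.erase_subset _ _))
        · refine (Finset.card_le_card ?_).trans hm
          intro w hw
          obtain ⟨e', he', h⟩ := mem_VF.1 hw
          exact mem_VF.2 ⟨e', Finset.erase_subset _ _ he', h⟩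
        · rw [Finset.card_erase_of_mem heI]; omega
      · refine ihm _ _ ?_ le_rfl ?_ hKS
        · have hsub : VF ends ((I \ inc ends I v) ∪ K) ⊆ (VF ends I).erase v := by
            intro w hw
            obtain ⟨e, he, h⟩ := mem_VF.1 hw
            rcases Finset.mem_union.1 he with he | he
            · rw [Finset.mem_sdiff, inc, Finset.mem_filter] at he
              refine Finset.mem_erase.2 ⟨?_, mem_VF.2 ⟨e, he.1, h⟩⟩
              rintro rfl
              exact he.2 ⟨he.1, h⟩
            · have hn : w ∈ nbr ends I v := by
                rcases h with h | h
                · rw [← h]; exact (hKn e he).1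
                · rw [← h]; exact (hKn e he).2.1
              obtain ⟨h1, e', he', -, h3⟩ := mem_nbr.1 hn
              exact Finset.mem_erase.2 ⟨h1, mem_VF.2 ⟨e', he', h3⟩⟩
          have := Finset.card_le_card hsub
          rw [Finset.card_erase_of_mem hv] at this
          omega
        · intro e he
          rcases Finset.mem_union.1 he with he | he
          · exact hl e (Finset.sdiff_subset he)
          · exact (hKn e he).2.2

end Main
end BRB

namespace BRB
open Module

/-! ### Necessity -/

section Nec
set_option linter.unusedSectionVars false
variable {d : ℕ} {V E : Type} [DecidableEq V] [DecidableEq E] [Fintype V]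
variable {R : Finset V} {ends : E → V × V}

lemma be_pair {f f' : Fin 2 → Wd d} (h : LinearIndependent ℝ ![f 0, f 1, f' 0, f' 1]) {s t : ℝ}
    (hst : s • be (f 0) (f 1) = t • be (f' 0) (f' 1)) : s = 0 := by
  obtain ⟨x, hx⟩ := dual_vecs h
  have e00 : f 0 ⬝ᵥ x 0 = 1 := by simpa using hx 0 0
  have e01 : f 0 ⬝ᵥ x 1 = 0 := by simpa using hx 0 1
  have e10 : f 1 ⬝ᵥ x 0 = 0 := by simpa using hx 1 0
  have e11 : f 1 ⬝ᵥ x 1 = 1 := by simpa using hx 1 1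
  have e20 : f' 0 ⬝ᵥ x 0 = 0 := by simpa using hx 2 0
  have e21 : f' 0 ⬝ᵥ x 1 = 0 := by simpa using hx 2 1
  have := congrArg (fun φ : Nn d => φ (wdg (x 0) (x 1))) hst
  simp only [LinearMap.smul_apply, be_wdg, e00, e01, e10, e11, e20, e21] at this
  simpa using this

lemma nec {P : Prm V E d} (hg1 : g1 P) {F : Finset E} (hl : ∀ e ∈ F, (ends e).1 ≠ (ends e).2)
    (hF : Good R ends F P) (hne : F.Nonempty) :
    (F.card : ℤ) ≤ ge ((d + 1).choose 2) R (VF ends F) := by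
  set X := VF ends F with hX
  let Dom := ({w // w ∈ Xᶜ} → Nn d) × Nn d × ({w // w ∈ X ∩ R} → ℝ)
  let ct : Dom → V → ℝ := fun z w => if h : w ∈ X ∩ R then z.2.2 ⟨w, h⟩ else 0
  have hadd : ∀ z z' w, ct (z + z') w = ct z w + ct z' w := by
    intro z z' w
    by_cases h : w ∈ X ∩ R
    · simp only [ct, dif_pos h]; rfl
    · simp only [ct, dif_neg h, add_zero]
  have hsmul : ∀ (t : ℝ) z w, ct (t • z) w = t * ct z w := by
    intro t z w
    by_cases h : w ∈ X ∩ R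
    · simp only [ct, dif_pos h]; rfl
    · simp only [ct, dif_neg h, mul_zero]
  let Θ : Dom →ₗ[ℝ] (V → Nn d) :=
    { toFun := fun z w => if h : w ∈ Xᶜ then z.1 ⟨w, h⟩ else
        z.2.1 + ct z w • be (P.1 w 0) (P.1 w 1)
      map_add' := by
        intro z z'
        funext w
        by_cases h : w ∈ Xᶜ
        · simp only [Pi.add_apply, dif_pos h]; rfl
        · simp only [Pi.add_apply, dif_neg h, hadd]
          show (z.2.1 + z'.2.1) + _ = _
          module
      map_smul' := by
        intro t z
        funext w
        by_cases h : w ∈ Xᶜ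
        · simp only [Pi.smul_apply, dif_pos h]; rfl
        · simp only [Pi.smul_apply, dif_neg h, hsmul, RingHom.id_apply]
          show t • z.2.1 + _ = _
          module }
  have hΘ1 : ∀ z w, w ∈ X → Θ z w = z.2.1 + ct z w • be (P.1 w 0) (P.1 w 1) := by
    intro z w hw
    have : w ∉ Xᶜ := by simpa using hw
    simp only [Θ, LinearMap.coe_mk, AddHom.coe_mk, this, dif_neg, not_false_eq_true]
  have hΘ2 : ∀ z w (hw : w ∈ Xᶜ), Θ z w = z.1 ⟨w, hw⟩ := by
    intro z w hw
    simp only [Θ, LinearMap.coe_mk, AddHom.coe_mk, hw, dif_pos]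
  have hother : ∀ w ∈ X, ∃ u ∈ X, u ≠ w := by
    intro w _
    obtain ⟨e, he⟩ := hne
    by_cases hw : (ends e).1 = w
    · exact ⟨(ends e).2, mem_VF.2 ⟨e, he, Or.inr rfl⟩, by rw [← hw]; exact (hl e he).symm⟩
    · exact ⟨(ends e).1, mem_VF.2 ⟨e, he, Or.inl rfl⟩, hw⟩
  have hinj : Function.Injective Θ := by
    rw [← LinearMap.ker_eq_bot, LinearMap.ker_eq_bot']
    intro z hz
    have hz' : ∀ w, Θ z w = 0 := fun w => by rw [hz]; rfl
    have hc : ∀ w ∈ X, ct z w = 0 := by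
      intro w hw
      obtain ⟨u, hu, huw⟩ := hother w hw
      have h1 := hz' w
      have h2 := hz' u
      rw [hΘ1 z w hw] at h1
      rw [hΘ1 z u hu, ← h1] at h2
      exact be_pair (hg1 (w, u) huw.symm) (add_left_cancel h2).symm
    refine Prod.ext ?_ (Prod.ext ?_ ?_)
    · funext w
      have := hz' w.1
      rw [hΘ2 z w.1 w.2] at this
      exact this
    · obtain ⟨e, he⟩ := hne
      have hm : (ends e).1 ∈ X := mem_VF.2 ⟨e, he, Or.inl rfl⟩
      have := hz' (ends e).1
      rw [hΘ1 z _ hm, hc _ hm, zero_smul, add_zero] at this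
      exact this
    · funext w
      have := hc w.1 (Finset.mem_inter.1 w.2).1
      simp only [ct, w.2, dif_pos] at this
      exact this
  have hrange : LinearMap.range Θ ≤ annE R ends P F := by
    rintro _ ⟨z, rfl⟩
    rw [mem_annE]
    intro e he
    have m1 : (ends e).1 ∈ X := mem_VF.2 ⟨e, he, Or.inl rfl⟩
    have m2 : (ends e).2 ∈ X := mem_VF.2 ⟨e, he, Or.inr rfl⟩
    have key : ∀ w, rV R P w (qV R ends P e) = 0 →
        (ct z w • be (P.1 w 0) (P.1 w 1)) (qV R ends P e) = 0 := by
      intro w hw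
      by_cases hwR : w ∈ R
      · rw [rV_eq] at hw
        simp only [hwR, if_true, one_smul] at hw
        rw [LinearMap.smul_apply, hw, smul_zero]
      · simp [ct, hwR]
    rw [hΘ1 z _ m1, hΘ1 z _ m2, LinearMap.add_apply, LinearMap.add_apply,
      key _ (rV_fst R ends P e), key _ (rV_snd R ends P e)]
  have h1 := Submodule.finrank_mono hrange
  rw [LinearMap.finrank_range_of_inj hinj] at h1
  have h2 := finrank_annE R ends hF
  have h3 : finrank ℝ Dom = (d + 1).choose 2 * (Fintype.card V - X.card) +
      ((d + 1).choose 2 + (X ∩ R).card) := by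
    rw [finrank_prod, finrank_prod, finrank_pi, finrank_pi_fintype, Finset.sum_const, finrank_Nn,
      Finset.card_univ, Fintype.card_coe, Fintype.card_coe, Finset.card_compl, smul_eq_mul, mul_comm]
  rw [h3] at h1
  have h4 : X.card ≤ Fintype.card V := Finset.card_le_univ X
  unfold ge
  zify [h4] at h1 h2
  nlinarith

end Nec

/-! ### The exterior algebra -/

section Ext
set_option linter.unusedSectionVars false
variable {d : ℕ}

lemma detF {k : ℕ} (L : Wd d →ₗ[ℝ] (Fin k → ℝ)) : ∃ Λ : ExtAlg d →ₗ[ℝ] ℝ, ∀ w : Fin k → Wd d,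
    Λ (List.ofFn fun i => ι ℝ (w i)).prod = Matrix.det (Matrix.of fun i => L (w i)) := by
  let A : (Wd d) [⋀^Fin k]→ₗ[ℝ] ℝ := (Matrix.detRowAlternating).compLinearMap L
  refine ⟨liftAlternating (Pi.single k A), ?_⟩
  intro w
  rw [← ιMulti_apply, liftAlternating_apply_ιMulti, Pi.single_eq_same]
  rfl

lemma prod_ne {k : ℕ} {w : Fin k → Wd d} (h : LinearIndependent ℝ w) :
    (List.ofFn fun i => ι ℝ (w i)).prod ≠ 0 := by
  have hinj : LinearMap.ker (Fintype.linearCombination ℝ w) = ⊥ := by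
    rw [LinearMap.ker_eq_bot]
    exact h.fintypeLinearCombination_injective
  obtain ⟨L, hL⟩ := LinearMap.exists_leftInverse_of_injective _ hinj
  obtain ⟨Λ, hΛ⟩ := detF L
  intro h0
  have h1 := hΛ w
  rw [h0, map_zero] at h1
  have h2 : (Matrix.of fun i => L (w i)) = (1 : Matrix (Fin k) (Fin k) ℝ) := by
    ext i j
    have := congrArg (fun f => f (Pi.single i 1)) hL
    simp only [LinearMap.comp_apply, LinearMap.id_apply] at this
    rw [Fintype.linearCombination_apply_single, one_smul] at this
    simp [this, Matrix.one_apply, Pi.single_apply, eq_comm]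
  rw [h2, Matrix.det_one] at h1
  exact zero_ne_one h1

lemma cons_prod {k : ℕ} (a : Wd d) (w : Fin k → Wd d) :
    ι ℝ a * (List.ofFn fun i => ι ℝ (w i)).prod =
      (List.ofFn fun i => ι ℝ ((Fin.cons a w : Fin (k + 1) → Wd d) i)).prod := by
  simp [List.ofFn_succ]

lemma mul_zero_of_mem {k : ℕ} {a : Wd d} {w : Fin k → Wd d}
    (h : a ∈ Submodule.span ℝ (Set.range w)) :
    ι ℝ a * (List.ofFn fun i => ι ℝ (w i)).prod = 0 := by
  rw [cons_prod, ← ιMulti_apply]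
  apply AlternatingMap.map_linearDependent
  rw [linearIndependent_finCons]
  exact fun h' => h'.2 h

lemma swap_mul (a b : Wd d) : ι ℝ a * ι ℝ b = - (ι ℝ b * ι ℝ a) :=
  eq_neg_of_add_eq_zero_left (ι_add_mul_swap a b)

lemma mul2_zero {k : ℕ} {a b : Wd d} {w : Fin k → Wd d}
    (h : a ∈ Submodule.span ℝ (Set.range w) ∨ b ∈ Submodule.span ℝ (Set.range w)) :
    (ι ℝ a * ι ℝ b) * (List.ofFn fun i => ι ℝ (w i)).prod = 0 := by
  rcases h with h | h
  · rw [swap_mul, neg_mul, mul_assoc, mul_zero_of_mem h, mul_zero, neg_zero]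
  · rw [mul_assoc, mul_zero_of_mem h, mul_zero]

lemma rod_exists (hd : 3 ≤ d) {f : Fin 2 → Wd d} (hf : LinearIndependent ℝ f) :
    ∃ u : Fin (d - 1) → Wd d, LinearIndependent ℝ u ∧
      ∀ a, a ∈ Submodule.span ℝ (Set.range u) ↔ ∀ i, f i ⬝ᵥ a = 0 := by
  obtain ⟨x, hx⟩ := dual_vecs hf
  let Φ : Wd d →ₗ[ℝ] (Fin 2 → ℝ) := LinearMap.pi fun i => dotProductEquiv ℝ (Fin (d + 1)) (f i)
  have hΦ : ∀ a i, Φ a i = f i ⬝ᵥ a := fun a i => rfl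
  have hsurj : LinearMap.range Φ = ⊤ := by
    rw [LinearMap.range_eq_top]
    intro c
    refine ⟨∑ j, c j • x j, ?_⟩
    funext i
    rw [hΦ, dotProduct_sum]
    simp [dotProduct_smul, hx]
  have hrk := LinearMap.finrank_range_add_finrank_ker Φ
  rw [hsurj, finrank_top, finrank_pi, finrank_pi, Fintype.card_fin, Fintype.card_fin] at hrk
  have hk : finrank ℝ (LinearMap.ker Φ) = d - 1 := by omega
  let bb := finBasisOfFinrankEq ℝ (LinearMap.ker Φ) hk
  refine ⟨fun i => (bb i : Wd d), ?_, ?_⟩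
  · exact bb.linearIndependent.map' (LinearMap.ker Φ).subtype (Submodule.ker_subtype _)
  · intro a
    have h1 : Submodule.span ℝ (Set.range fun i => (bb i : Wd d)) = LinearMap.ker Φ := by
      have : (Set.range fun i => (bb i : Wd d)) = (LinearMap.ker Φ).subtype '' (Set.range bb) := by
        rw [← Set.range_comp]; rfl
      rw [this, Submodule.span_image, bb.span_eq, Submodule.map_top, Submodule.range_subtype]
    rw [h1, LinearMap.mem_ker, funext_iff]
    rfl

noncomputable def Psi : Mm d →ₗ[ℝ] ExtAlg d :=
  Fintype.linearCombination ℝ (fun p : Kp d => ι ℝ (bs p.1.1) * ι ℝ (bs p.1.2))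

lemma Psi_wdg (a b : Wd d) : Psi (wdg a b) = ι ℝ a * ι ℝ b := by
  have hexp : ∀ a : Wd d, ι ℝ a = ∑ i, a i • ι ℝ (bs (d := d) i) := by
    intro a
    have : a = ∑ i, a i • bs (d := d) i := by
      rw [pi_eq_sum_univ' a]
      simp [bs, Finset.sum_apply, Pi.single_apply]
    conv_lhs => rw [this]
    rw [map_sum]
    simp only [map_smul]
  have h := sum_pairs (d := d) (fun i j => (a i * b j) • (ι ℝ (bs (d := d) i) * ι ℝ (bs j)))
    (by intro i; rw [ι_sq_zero, smul_zero])
  have h1 : ι ℝ a * ι ℝ b = ∑ i, ∑ j, (a i * b j) • (ι ℝ (bs (d := d) i) * ι ℝ (bs j)) := by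
    rw [hexp a, hexp b, Finset.sum_mul_sum]
    simp only [smul_mul_smul_comm]
  rw [h1, ← h, Psi, Fintype.linearCombination_apply]
  refine Finset.sum_congr rfl fun p _ => ?_
  rw [wdg_apply, swap_mul (bs p.1.2) (bs p.1.1)]
  module

lemma Psi_inj : LinearMap.ker (Psi (d := d)) = ⊥ := by
  rw [LinearMap.ker_eq_bot']
  intro m hm
  funext p
  let L : Wd d →ₗ[ℝ] (Fin 2 → ℝ) := LinearMap.pi ![LinearMap.proj p.1.1, LinearMap.proj p.1.2]
  obtain ⟨Λ, hΛ⟩ := detF L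
  have h2 : ∀ a b : Wd d, Λ (ι ℝ a * ι ℝ b) = wdg a b p := by
    intro a b
    have := hΛ ![a, b]
    simp only [List.ofFn_succ, List.ofFn_zero, List.prod_cons, List.prod_nil, mul_one] at this
    rw [Matrix.det_fin_two] at this
    simpa [L, wdg_apply] using this
  have h3 : Λ (Psi m) = m p := by
    rw [Psi, Fintype.linearCombination_apply, map_sum]
    simp only [map_smul, h2, bs, wdg_basis]
    simp [Pi.single_apply]
  rw [← h3, hm, map_zero]; rfl

end Ext
end BRB

namespace BRB
open Module

/-! ### Assembly -/

section Fin
set_option linter.unusedSectionVars false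
variable {d : ℕ} {V E : Type} [DecidableEq V] [DecidableEq E] [Fintype V]
variable {R : Finset V}

def en (ends : E → V × V) : E ⊕ (V × V × ℕ) → V × V := Sum.elim ends (fun p => (p.1, p.2.1))

lemma en_fresh (ends : E → V × V) (a b : V) (s : Finset (E ⊕ (V × V × ℕ))) :
    ∃ e ∉ s, en ends e = (a, b) := by
  obtain ⟨n, hn⟩ := (Set.infinite_range_of_injective
    (f := fun n : ℕ => (Sum.inr (a, b, n) : E ⊕ (V × V × ℕ)))
    (by intro m n h; simpa using h)).exists_notMem_finset s
  obtain ⟨⟨m, rfl⟩, h2⟩ := hn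
  exact ⟨_, h2, rfl⟩

def em : E ↪ E ⊕ (V × V × ℕ) := Function.Embedding.inl

lemma VF_map (ends : E → V × V) (F : Finset E) : VF (en ends) (F.map em) = VF ends F := by
  ext w
  rw [mem_VF, mem_VF]
  simp [em, en]

lemma Sp_map {D : ℕ} {ends : E → V × V} {I : Finset E} (h : Sp D R ends I) :
    Sp D R (en ends) (I.map em) := by
  intro U hU
  have : eU (en ends) (I.map em) U = (eU ends I U).map em := by
    ext x
    simp only [eU, Finset.mem_filter, Finset.mem_map]
    constructor
    · rintro ⟨⟨e, he, rfl⟩, h⟩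
      exact ⟨e, ⟨he, h⟩, rfl⟩
    · rintro ⟨e, ⟨he, h⟩, rfl⟩
      exact ⟨⟨e, he, rfl⟩, h⟩
  rw [this, Finset.card_map]
  exact h U hU

lemma Good_map {ends : E → V × V} {P : Prm V (E ⊕ (V × V × ℕ)) d} (I : Finset E) :
    Good R (en ends) (I.map em) P ↔
      LinearIndependent ℝ (fun e : {x // x ∈ I} => vec R (en ends) P (em e.1)) := by
  let f : {x // x ∈ I} → {x // x ∈ I.map (em (V := V))} :=
    fun e => ⟨em e.1, Finset.mem_map_of_mem _ e.2⟩
  have hf : Function.Bijective f := by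
    constructor
    · intro a b h
      exact Subtype.ext (em.injective (congrArg Subtype.val h))
    · rintro ⟨x, hx⟩
      obtain ⟨e, he, rfl⟩ := Finset.mem_map.1 hx
      exact ⟨⟨e, he⟩, rfl⟩
  exact (linearIndependent_equiv (Equiv.ofBijective f hf)).symm

lemma vec_em {ends : E → V × V} {P : Prm V (E ⊕ (V × V × ℕ)) d} (e : E) :
    vec R (en ends) P (em e) = Pi.single (ends e).1 (qV R (en ends) P (em e)) -
      Pi.single (ends e).2 (qV R (en ends) P (em e)) := rfl

lemma compLeft_single (w : V) (q : Mm d) :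
    (Psi (d := d)).compLeft V (Pi.single w q) = Pi.single w (Psi q) := by
  funext x
  rw [LinearMap.compLeft_apply, Function.comp_apply, Pi.single_apply, Pi.single_apply]
  split_ifs <;> simp

lemma Psi_qV {ends : E → V × V} {P : Prm V (E ⊕ (V × V × ℕ)) d} (e : E) :
    Psi (qV R (en ends) P (em e)) =
      ι ℝ (aV R (en ends) P (em e)) * ι ℝ (bV R (en ends) P (em e)) := Psi_wdg _ _

lemma LI_transfer {ends : E → V × V} {P : Prm V (E ⊕ (V × V × ℕ)) d} (I : Finset E) :
    LinearIndependent ℝ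
      (fun e : {x // x ∈ I} =>
        (Pi.single (ends e.1).1 (ι ℝ (aV R (en ends) P (em e.1)) *
            ι ℝ (bV R (en ends) P (em e.1)))
          - Pi.single (ends e.1).2 (ι ℝ (aV R (en ends) P (em e.1)) *
            ι ℝ (bV R (en ends) P (em e.1))) : V → ExtAlg d)) ↔
      Good R (en ends) (I.map em) P := by
  rw [Good_map]
  have hker : LinearMap.ker ((Psi (d := d)).compLeft V) = ⊥ := by
    rw [LinearMap.ker_eq_bot]
    intro x y hxy
    funext w
    exact LinearMap.ker_eq_bot.1 Psi_inj (congrFun hxy w)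
  have hfun : (fun e : {x // x ∈ I} =>
        (Pi.single (ends e.1).1 (ι ℝ (aV R (en ends) P (em e.1)) *
            ι ℝ (bV R (en ends) P (em e.1)))
          - Pi.single (ends e.1).2 (ι ℝ (aV R (en ends) P (em e.1)) *
            ι ℝ (bV R (en ends) P (em e.1))) : V → ExtAlg d)) =
      (Psi (d := d)).compLeft V ∘ (fun e : {x // x ∈ I} => vec R (en ends) P (em e.1)) := by
    funext e
    rw [← Psi_qV, Function.comp_apply, vec_em, map_sub, compLeft_single, compLeft_single]
  rw [hfun]
  exact LinearMap.linearIndependent_iff _ hker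

end Fin
end BRB

theorem statement_0
    (d : ℕ) (hd : 3 ≤ d) (D : ℕ) (hD : D = (d + 1).choose 2)
    (V E : Type) [Fintype V] [Fintype E] [DecidableEq V] [DecidableEq E]
    (ends : E → V × V) (hloop : ∀ e : E, (ends e).1 ≠ (ends e).2)
    (B R : Finset V) (hdisj : Disjoint B R) (hcov : B ∪ R = Finset.univ) :
    ∃ (r : V → ExtAlg d) (a b : E → Wd d),
      (∀ v ∈ R, r v ≠ 0) ∧
      (∀ v ∈ R, IsDecomp d (d - 1) (r v)) ∧
      (∀ u ∈ R, ∀ v ∈ R, u ≠ v → ∀ c : ℝ, r u ≠ c • r v) ∧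
      (∀ e : E, ι ℝ (a e) * ι ℝ (b e) ≠ 0) ∧
      (∀ e : E, ∀ w ∈ R, (w = (ends e).1 ∨ w = (ends e).2) →
        (ι ℝ (a e) * ι ℝ (b e)) * r w = 0) ∧
      (∀ I : Finset E,
        LinearIndependent ℝ
          (fun e : {x // x ∈ I} =>
            (Pi.single (ends e.1).1 (ι ℝ (a e.1) * ι ℝ (b e.1))
              - Pi.single (ends e.1).2 (ι ℝ (a e.1) * ι ℝ (b e.1)) : V → ExtAlg d)) ↔
          ∀ F ⊆ I, F.Nonempty →
            (F.card : ℤ) ≤ D * (VF ends F).card - D - ((VF ends F) ∩ R).card) := by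
  subst hD
  have hD6 : 6 ≤ (d + 1).choose 2 := by
    have := Nat.choose_le_choose 2 (show 4 ≤ d + 1 by omega)
    simpa [Nat.choose] using this
  let E' := E ⊕ (V × V × ℕ)
  let S : Set (Finset E) := {I | BRB.Sp ((d + 1).choose 2) R ends I}
  have hSf : S.Finite := Set.toFinite _
  have hLF : BRB.LO (fun P : BRB.Prm V E' d => ∀ v ∈ (Set.univ : Set V),
      LinearIndependent ℝ (P.1 v)) := by
    refine BRB.LO.all _ (Set.toFinite _) fun v _ => ?_
    exact BRB.LPv.LI (fun i => BRB.LPv_fr v i)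
  have hLS : BRB.LO (fun P : BRB.Prm V E' d => ∀ I ∈ S,
      BRB.Good R (BRB.en ends) (I.map BRB.em) P) :=
    BRB.LO.all _ hSf fun I _ => BRB.Good_LO _ _ _
  obtain ⟨P, ⟨hgg, hfr⟩, hgood⟩ : ∃ P : BRB.Prm V E' d, (BRB.gg hd P ∧ (∀ v ∈ (Set.univ : Set V),
      LinearIndependent ℝ (P.1 v))) ∧ ∀ I ∈ S,
      BRB.Good R (BRB.en ends) (I.map BRB.em) P := by
    refine BRB.LO.exists_and ((BRB.gg_LO hd).and hLF) hLS
      (BRB.LO.exists_and (BRB.gg_LO hd) hLF (BRB.gg_ne hd) ?_) ?_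
    · refine ⟨(fun _ => ![BRB.bs ⟨0, by omega⟩, BRB.bs ⟨1, by omega⟩], 0), fun v _ => ?_⟩
      have h := (Pi.basisFun ℝ (Fin (d + 1))).linearIndependent.comp
        ![⟨0, by omega⟩, ⟨1, by omega⟩] (by
          intro a b hab
          fin_cases a <;> fin_cases b <;> simp at hab ⊢)
      convert h using 1
      funext k; fin_cases k <;> simp [BRB.bs]
    · refine BRB.LO.exists_all _ hSf (fun I _ => BRB.Good_LO _ _ _) ?_
      intro I hI
      refine BRB.T hd (BRB.en_fresh ends) _ _ (I.map BRB.em) le_rfl le_rfl ?_ (BRB.Sp_map hI)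
      intro e he
      obtain ⟨e, -, rfl⟩ := Finset.mem_map.1 he
      exact hloop e
  have hrod : ∀ v, ∃ u : Fin (d - 1) → Wd d, LinearIndependent ℝ u ∧
      ∀ a, a ∈ Submodule.span ℝ (Set.range u) ↔ ∀ i, P.1 v i ⬝ᵥ a = 0 :=
    fun v => BRB.rod_exists hd (hfr v trivial)
  choose u hu hspan using hrod
  have hLI : ∀ I : Finset E, LinearIndependent ℝ
      (fun e : {x // x ∈ I} =>
        (Pi.single (ends e.1).1 (ι ℝ (BRB.aV R (BRB.en ends) P (BRB.em e.1)) *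
            ι ℝ (BRB.bV R (BRB.en ends) P (BRB.em e.1)))
          - Pi.single (ends e.1).2 (ι ℝ (BRB.aV R (BRB.en ends) P (BRB.em e.1)) *
            ι ℝ (BRB.bV R (BRB.en ends) P (BRB.em e.1))) : V → ExtAlg d)) ↔
      BRB.Good R (BRB.en ends) (I.map BRB.em) P := by
    intro I
    exact BRB.LI_transfer I
  have hcount : ∀ I : Finset E, BRB.Sp ((d + 1).choose 2) R ends I →
      BRB.Good R (BRB.en ends) (I.map BRB.em) P := fun I hI => hgood I hI
  refine ⟨fun v => (List.ofFn fun i => ι ℝ (u v i)).prod,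
    fun e => BRB.aV R (BRB.en ends) P (BRB.em e), fun e => BRB.bV R (BRB.en ends) P (BRB.em e),
    fun v _ => BRB.prod_ne (hu v), fun v _ => ⟨u v, rfl⟩, ?_, ?_, ?_, ?_⟩
  · intro v _ w _ hvw c hc
    beta_reduce at hc
    obtain ⟨x, hx⟩ := BRB.dual_vecs (hgg.1 (v, w) hvw)
    have m1 : x 2 ∈ Submodule.span ℝ (Set.range (u v)) := by
      rw [hspan]
      intro i
      fin_cases i
      · simpa using hx 0 2
      · simpa using hx 1 2
    have m2 : x 2 ∉ Submodule.span ℝ (Set.range (u w)) := by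
      rw [hspan]
      intro h
      have h1 := hx 2 2
      have h2 := h 0
      simp at h1
      rw [h1] at h2
      exact one_ne_zero h2
    have h3 := BRB.mul_zero_of_mem m1
    have h4 : ι ℝ (x 2) * (List.ofFn fun i => ι ℝ (u w i)).prod ≠ 0 := by
      rw [BRB.cons_prod]
      exact BRB.prod_ne (linearIndependent_finCons.2 ⟨hu w, m2⟩)
    rw [hc, mul_smul_comm] at h3
    have hc0 : c = 0 := by
      rcases smul_eq_zero.1 h3 with h | h
      · exact h
      · exact absurd h h4
    rw [hc0, zero_smul] at hc
    exact BRB.prod_ne (hu v) hc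
  · intro e h0
    have hs : BRB.Sp ((d + 1).choose 2) R ends {e} := by
      apply BRB.Sp_of_count (by omega)
      intro F hF hne
      have hFe : F = {e} := by
        rcases Finset.subset_singleton_iff.1 hF with h | h
        · exact absurd h hne.ne_empty
        · exact h
      have h2 : (VF ends F).card = 2 := by
        rw [hFe]
        simp only [VF, Finset.image_singleton]
        exact Finset.card_pair (hloop e)
      have h3 : (VF ends F ∩ R).card ≤ 2 := by
        rw [← h2]; exact Finset.card_le_card Finset.inter_subset_left
      rw [h2, hFe, Finset.card_singleton]
      rw [hFe] at h3
      push_cast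
      zify at h3 hD6
      linarith
    have h1 := (hLI {e}).2 (hcount _ hs)
    have h2 := h1.ne_zero ⟨e, Finset.mem_singleton_self e⟩
    apply h2
    simp only [h0]
    simp
  · intro e w hw hwe
    apply BRB.mul2_zero
    rcases hwe with rfl | rfl
    · left
      rw [hspan]
      exact BRB.pt_onU ((ends e).1 ∈ R) (P.1 (ends e).1) (P.2 (BRB.em e) 0) hw
    · right
      rw [hspan]
      exact BRB.pt_onU ((ends e).2 ∈ R) (P.1 (ends e).2) (P.2 (BRB.em e) 1) hw
  · intro I
    rw [hLI I]
    constructor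
    · intro h F hF hne
      have hF' : BRB.Good R (BRB.en ends) (F.map BRB.em) P := h.mono (Finset.map_subset_map.2 hF)
      have := BRB.nec hgg.1 (by
        intro e he
        obtain ⟨e, -, rfl⟩ := Finset.mem_map.1 he
        exact hloop e) hF' (hne.map)
      rw [BRB.VF_map, Finset.card_map] at this
      exact this
    · intro h
      exact hcount I (BRB.Sp_of_count (by omega) h)
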